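/- arXiv:1111.1064 — 2 statements merged into one kernel-verified Lean document; each statement's English description precedes it below -/
import Mathlib

section
/- Every non-zero Turing degree that is bounded by a 2-random Turing degree is hyperimmune. -/
/-
Common framework: oracle (relative) partial computability via codes,
Turing reducibility, the jump, Cantor-space measure, Martin-Löf randomness
and genericity relative to an oracle, Turing functionals.
-/

open scoped ENNReal

namespace TypicalDegree

/-- Codes for partial functions recursive in an oracle (Kleene-style),
    following `Nat.Partrec.Code` with an extra `oracle` constructor. -/
inductive OracleCode : Type
  | zero : OracleCode
  | succ : OracleCode
  | left : OracleCode
  | right : OracleCode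
  | oracle : OracleCode
  | pair : OracleCode → OracleCode → OracleCode
  | comp : OracleCode → OracleCode → OracleCode
  | prec : OracleCode → OracleCode → OracleCode
  | rfind' : OracleCode → OracleCode

/-- Evaluation of an oracle code relative to an oracle `g : ℕ →. ℕ`. -/
def OracleCode.eval (g : ℕ →. ℕ) : OracleCode → ℕ →. ℕ
  | .zero => pure 0
  | .succ => Nat.succ
  | .left => ↑fun n : ℕ => n.unpair.1
  | .right => ↑fun n : ℕ => n.unpair.2
  | .oracle => g
  | .pair cf cg => fun n => Nat.pair <$> OracleCode.eval g cf n <*> OracleCode.eval g cg n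
  | .comp cf cg => fun n => OracleCode.eval g cg n >>= OracleCode.eval g cf
  | .prec cf cg =>
    Nat.unpaired fun a n =>
      n.rec (OracleCode.eval g cf a) fun y IH => do
        let i ← IH
        OracleCode.eval g cg (Nat.pair a (Nat.pair y i))
  | .rfind' cf =>
    Nat.unpaired fun a m =>
      (Nat.rfind fun n => (fun m => m = 0) <$> OracleCode.eval g cf (Nat.pair a (n + m))).map
        (· + m)

/-- An effective injective numbering of oracle codes. -/
def OracleCode.encodeCode : OracleCode → ℕ
  | .zero => 0
  | .succ => 1
  | .left => 2
  | .right => 3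
  | .oracle => 4
  | .pair cf cg => 4 * Nat.pair cf.encodeCode cg.encodeCode + 5
  | .comp cf cg => 4 * Nat.pair cf.encodeCode cg.encodeCode + 6
  | .prec cf cg => 4 * Nat.pair cf.encodeCode cg.encodeCode + 7
  | .rfind' cf => 4 * Nat.pair cf.encodeCode cf.encodeCode + 8

/-- The characteristic (total) oracle of an element of Cantor space. -/
def chi (X : ℕ → Bool) : ℕ →. ℕ := fun n => Part.some (cond (X n) 1 0)

/-- `f` is partial recursive relative to the oracle `g`. -/
def RedIn (f g : ℕ →. ℕ) : Prop := ∃ c : OracleCode, c.eval g = f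

/-- A total function `ℕ → ℕ` viewed as a partial function. -/
def natFun (f : ℕ → ℕ) : ℕ →. ℕ := fun n => Part.some (f n)

/-- Turing reducibility between elements of Cantor space. -/
def TRed (X Y : ℕ → Bool) : Prop := RedIn (chi X) (chi Y)

/-- Turing equivalence. -/
def TEquiv (X Y : ℕ → Bool) : Prop := TRed X Y ∧ TRed Y X

/-- `X` is computable. -/
def ComputableSeq (X : ℕ → Bool) : Prop := TRed X fun _ => false

/-- `f : ℕ → ℕ` is computable. -/
def ComputableFun (f : ℕ → ℕ) : Prop := RedIn (natFun f) (chi fun _ => false)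

/-- The Turing jump of `X`: the halting problem relative to `X`,
    under the numbering `encodeCode`. -/
noncomputable def jump (X : ℕ → Bool) : ℕ → Bool := fun n =>
  @decide (∃ c : OracleCode, c.encodeCode = n ∧ (c.eval (chi X) n).Dom) (Classical.dec _)

/-- `∅'`, the halting problem. -/
noncomputable def zeroJump : ℕ → Bool := jump fun _ => false

/-- `X` extends the finite binary string `σ` (i.e. `σ ⊂ X`). -/
def extendsStr (X : ℕ → Bool) (σ : List Bool) : Prop :=
  ∀ i : Fin σ.length, X i.1 = σ.get i

/-- `⟦V⟧`: the open set of infinite sequences extending some string in `V`. -/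
def openOf (V : Set (List Bool)) : Set (ℕ → Bool) := {X | ∃ σ ∈ V, extendsStr X σ}

/-- The (fair-coin) measure of the open set `⟦V⟧` determined by a set of strings `V`:
    the supremum over `n` of the proportion of length-`n` strings with a prefix in `V`. -/
noncomputable def stringMeasure (V : Set (List Bool)) : ℝ≥0∞ :=
  ⨆ n : ℕ, (Nat.card {f : Fin n → Bool // ∃ σ ∈ V, σ <+: List.ofFn f} : ℝ≥0∞) / 2 ^ n

/-- The fair-coin (Lebesgue) measure on Cantor space, as the outer measure obtained from
    open coverings by sets of strings; it agrees with Lebesgue measure on measurable sets. -/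
noncomputable def cantorMeasure (S : Set (ℕ → Bool)) : ℝ≥0∞ :=
  ⨅ (V : Set (List Bool)) (_ : S ⊆ openOf V), stringMeasure V

/-- `W` is computably enumerable relative to `X`. -/
def CEIn (X : ℕ → Bool) (W : Set (List Bool)) : Prop :=
  ∃ c : OracleCode, ∀ σ : List Bool, σ ∈ W ↔ (c.eval (chi X) (Encodable.encode σ)).Dom

/-- `W` is computably enumerable. -/
def CE (W : Set (List Bool)) : Prop := CEIn (fun _ => false) W

/-- The c.e. set of strings with index `d`. -/
def ceSetOf (d : OracleCode) : Set (List Bool) :=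
  {σ | (d.eval (chi fun _ => false) (Encodable.encode σ)).Dom}

/-- The sequence `V` of sets of strings is uniformly c.e. relative to `X`. -/
def UniformCEIn (X : ℕ → Bool) (V : ℕ → Set (List Bool)) : Prop :=
  ∃ c : OracleCode, ∀ (i : ℕ) (σ : List Bool),
    σ ∈ V i ↔ (c.eval (chi X) (Nat.pair i (Encodable.encode σ))).Dom

/-- A Martin-Löf test relative to `X`. -/
def MLTest (X : ℕ → Bool) (V : ℕ → Set (List Bool)) : Prop :=
  UniformCEIn X V ∧ ∀ i : ℕ, stringMeasure (V i) < (2 : ℝ≥0∞)⁻¹ ^ i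

/-- `Y` is Martin-Löf random relative to `X`. -/
def MLRandomIn (X Y : ℕ → Bool) : Prop :=
  ∀ V : ℕ → Set (List Bool), MLTest X V → ∃ i, Y ∉ openOf (V i)

/-- `Y` is 1-random. -/
def OneRandom (Y : ℕ → Bool) : Prop := MLRandomIn (fun _ => false) Y

/-- `Y` is 2-random: Martin-Löf random relative to `∅'`. -/
def TwoRandom (Y : ℕ → Bool) : Prop := MLRandomIn zeroJump Y

/-- `Y` is weakly 2-random: it avoids every null `Π⁰₂` class
    (every null intersection of a uniformly c.e. sequence of open sets). -/
def Weak2Random (Y : ℕ → Bool) : Prop :=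
  ∀ V : ℕ → Set (List Bool), UniformCEIn (fun _ => false) V →
    cantorMeasure (⋂ i, openOf (V i)) = 0 → Y ∉ ⋂ i, openOf (V i)

/-- `Y` is 1-generic relative to `X`. -/
def OneGenericIn (X Y : ℕ → Bool) : Prop :=
  ∀ W : Set (List Bool), CEIn X W →
    ∃ σ : List Bool, extendsStr Y σ ∧ (σ ∈ W ∨ ∀ τ : List Bool, σ <+: τ → τ ∉ W)

/-- `Y` is 1-generic. -/
def OneGeneric (Y : ℕ → Bool) : Prop := OneGenericIn (fun _ => false) Y

/-- `Y` is 2-generic: 1-generic relative to `∅'`. -/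
def TwoGeneric (Y : ℕ → Bool) : Prop := OneGenericIn zeroJump Y

/-- The Turing functional coded by `c` is total on oracle `X` with value `Y ∈ 2^ω`
    (i.e. `Ψ^X = Y`). -/
def FTotal (c : OracleCode) (X : ℕ → Bool) (Y : ℕ → Bool) : Prop :=
  c.eval (chi X) = chi Y

/-- `Ψ^X ⊇ σ`: the output of the functional `c` on oracle `X` extends the string `σ`. -/
def FExtends (c : OracleCode) (X : ℕ → Bool) (σ : List Bool) : Prop :=
  ∀ i : Fin σ.length, c.eval (chi X) i.1 = Part.some (cond (σ.get i) 1 0)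

/-- `π(Ψ,σ) = μ({X : Ψ^X ⊇ σ})`. -/
noncomputable def piMeasure (c : OracleCode) (σ : List Bool) : ℝ≥0∞ :=
  cantorMeasure {X | FExtends c X σ}

/-- A Turing functional is special if every infinite binary sequence
    in its range is incomputable. -/
def Special (c : OracleCode) : Prop :=
  ∀ X Y : ℕ → Bool, FTotal c X Y → ¬ ComputableSeq Y

/-- The code `c` computes the total function `T` on strings (no oracle). -/
def ComputesFun (c : OracleCode) (T : List Bool → Bool) : Prop :=
  ∀ σ : List Bool, c.eval (chi fun _ => false) (Encodable.encode σ) = Part.some (cond (T σ) 1 0)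

/-- `T` is (the characteristic function of) a tree: closed under prefixes. -/
def IsTree (T : List Bool → Bool) : Prop :=
  ∀ σ τ : List Bool, σ <+: τ → T τ = true → T σ = true

/-- The set of infinite paths through the tree `T`; `Π⁰₁` classes are the
    sets of paths through computable trees. -/
def pathsOf (T : List Bool → Bool) : Set (ℕ → Bool) :=
  {X | ∀ n : ℕ, T (List.ofFn fun i : Fin n => X i.1) = true}

/-- The computable join `X ⊕ Y`. -/
def join (X Y : ℕ → Bool) : ℕ → Bool := fun n =>
  if n % 2 = 0 then X (n / 2) else Y (n / 2)

/-- A finite string used as a (partial) oracle. -/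
def strOracle (τ : List Bool) : ℕ →. ℕ := fun n =>
  if h : n < τ.length then Part.some (cond (τ.get ⟨n, h⟩) 1 0) else Part.none

/-- `Ψ^{τ₀}` and `Ψ^{τ₁}` are incompatible: they give different outputs somewhere. -/
def SplitPair (c : OracleCode) (τ₀ τ₁ : List Bool) : Prop :=
  ∃ (n v₀ v₁ : ℕ), v₀ ∈ c.eval (strOracle τ₀) n ∧ v₁ ∈ c.eval (strOracle τ₁) n ∧ v₀ ≠ v₁

/-- `(U,V)` is a `Ψ`-splitting above `τ`. -/
def SplittingAbove (c : OracleCode) (τ : List Bool) (U V : Finset (List Bool)) : Prop :=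
  (∃ ℓ : ℕ, ∀ σ ∈ U ∪ V, σ.length = ℓ ∧ τ <+: σ) ∧
    ∀ σ₀ ∈ U, ∀ σ₁ ∈ V, SplitPair c σ₀ σ₁

/-- The output sequence `Ψ^X` of the functional `c` on oracle `X`
    (defaults to `false` when not total). -/
noncomputable def outSeq (c : OracleCode) (X : ℕ → Bool) : ℕ → Bool := fun n =>
  @dite _ (∃ Y : ℕ → Bool, FTotal c X Y) (Classical.dec _) (fun h => h.choose n) fun _ => false

/-- `Ψ^X ↾ n`, as a finite string. -/
noncomputable def outStr (c : OracleCode) (X : ℕ → Bool) (n : ℕ) : List Bool :=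
  List.ofFn fun i : Fin n => outSeq c X i.1

/-- The degree of `M` is a minimal Turing degree. -/
def MinimalDeg (M : ℕ → Bool) : Prop :=
  ¬ ComputableSeq M ∧ ∀ Z : ℕ → Bool, TRed Z M → ComputableSeq Z ∨ TRed M Z


/-! ### Bridging with Mathlib's computability -/

theorem redIn_of_recursiveIn {g f : ℕ →. ℕ} (h : Nat.RecursiveIn {g} f) : RedIn f g := by
  induction h with
  | zero => exact ⟨.zero, rfl⟩
  | succ => exact ⟨.succ, rfl⟩
  | left => exact ⟨.left, rfl⟩
  | right => exact ⟨.right, rfl⟩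
  | oracle h hh => exact ⟨.oracle, by rw [Set.mem_singleton_iff.1 hh]; rfl⟩
  | pair _ _ ih₁ ih₂ =>
    obtain ⟨c, rfl⟩ := ih₁
    obtain ⟨d, rfl⟩ := ih₂
    exact ⟨.pair c d, rfl⟩
  | comp _ _ ih₁ ih₂ =>
    obtain ⟨c, rfl⟩ := ih₁
    obtain ⟨d, rfl⟩ := ih₂
    exact ⟨.comp c d, rfl⟩
  | prec _ _ ih₁ ih₂ =>
    obtain ⟨c, rfl⟩ := ih₁
    obtain ⟨d, rfl⟩ := ih₂
    exact ⟨.prec c d, rfl⟩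
  | rfind _ ih =>
    obtain ⟨c, rfl⟩ := ih
    refine ⟨.comp (.rfind' c) (.pair (.pair .left .right) .zero), ?_⟩
    funext n
    have h0 : OracleCode.eval g .zero n = Part.some 0 := rfl
    have h1 : OracleCode.eval g .left n = Part.some n.unpair.1 := rfl
    have h2 : OracleCode.eval g .right n = Part.some n.unpair.2 := rfl
    simp [OracleCode.eval, Seq.seq, Nat.unpaired]
    simp [pure, PFun.pure, Part.map_id']

theorem redIn_of_partrec {g f : ℕ →. ℕ} (h : Nat.Partrec f) : RedIn f g :=
  redIn_of_recursiveIn h.recursiveIn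

theorem eval_partrec {g : ℕ →. ℕ} (hg : Nat.Partrec g) (c : OracleCode) :
    Nat.Partrec (c.eval g) := by
  induction c with
  | zero => exact .zero
  | succ => exact .succ
  | left => exact .left
  | right => exact .right
  | oracle => exact hg
  | pair _ _ h₁ h₂ => exact .pair h₁ h₂
  | comp _ _ h₁ h₂ => exact .comp h₁ h₂
  | prec _ _ h₁ h₂ => exact .prec h₁ h₂
  | rfind' _ h => exact Nat.Partrec.rfind' h

theorem chi_false_partrec : Nat.Partrec (chi fun _ => false) :=
  Nat.Partrec.of_eq (Nat.Partrec.zero) fun _ => rfl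

theorem partrec_of_computableFun {g : ℕ → ℕ} (h : ComputableFun g) : Nat.Partrec (natFun g) := by
  obtain ⟨c, hc⟩ := h
  rw [← hc]
  exact eval_partrec chi_false_partrec c


theorem eval_comp (g : ℕ →. ℕ) (c d : OracleCode) (n : ℕ) :
    (OracleCode.comp c d).eval g n = (d.eval g n).bind (fun a => c.eval g a) := rfl

theorem eval_pair (g : ℕ →. ℕ) (c d : OracleCode) (n : ℕ) :
    (OracleCode.pair c d).eval g n =
      (c.eval g n).bind fun a => (d.eval g n).map fun b => Nat.pair a b := by
  simp [OracleCode.eval, Seq.seq, Part.bind_map]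

theorem evalPrec (g : ℕ →. ℕ) (c d : OracleCode) (n : ℕ) :
    (OracleCode.prec c d).eval g n =
      Nat.rec (motive := fun _ => Part ℕ) (c.eval g n.unpair.1) (fun y IH => IH.bind fun i =>
        d.eval g (Nat.pair n.unpair.1 (Nat.pair y i))) n.unpair.2 := rfl

theorem evalPrec_succ (g : ℕ →. ℕ) (c d : OracleCode) (a n : ℕ) :
    (OracleCode.prec c d).eval g (Nat.pair a (n + 1)) =
      ((OracleCode.prec c d).eval g (Nat.pair a n)).bind fun i =>
        d.eval g (Nat.pair a (Nat.pair n i)) := by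
  simp [evalPrec]

theorem evalPrec_zero (g : ℕ →. ℕ) (c d : OracleCode) (a : ℕ) :
    (OracleCode.prec c d).eval g (Nat.pair a 0) = c.eval g a := by
  simp [evalPrec]

theorem eval_rfind (g : ℕ →. ℕ) (c : OracleCode) (n : ℕ) :
    (OracleCode.rfind' c).eval g n =
      (Nat.rfind fun k => (c.eval g (Nat.pair n.unpair.1 (k + n.unpair.2))).map
        fun m => decide (m = 0)).map (· + n.unpair.2) := rfl

theorem mem_eval_rfind (g : ℕ →. ℕ) (c : OracleCode) (n v : ℕ) :
    v ∈ (OracleCode.rfind' c).eval g n ↔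
      ∃ a, 0 ∈ c.eval g (Nat.pair n.unpair.1 (a + n.unpair.2)) ∧
        (∀ k < a, ∃ y ∈ c.eval g (Nat.pair n.unpair.1 (k + n.unpair.2)), y ≠ 0) ∧
        a + n.unpair.2 = v := by
  rw [eval_rfind, Part.mem_map_iff]
  refine exists_congr fun a => ?_
  refine (and_congr_left' Nat.mem_rfind).trans ?_
  rw [and_assoc]
  simp [Part.mem_map_iff]

/-! ### Evaluation with string oracles -/

theorem strOracle_eq (τ : List Bool) (n : ℕ) :
    strOracle τ n = ((τ[n]?).map fun b => cond b 1 0 : Option ℕ) := by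
  unfold strOracle
  split_ifs with h
  · simp [h]
  · simp [List.getElem?_eq_none (not_lt.1 h)]

set_option maxHeartbeats 1000000 in
theorem eval_str_partrec (c : OracleCode) :
    Partrec₂ fun (τ : List Bool) (n : ℕ) => c.eval (strOracle τ) n := by
  induction c with
  | zero => exact (Computable.const 0).partrec
  | succ => exact (Computable.succ.comp Computable.snd).partrec
  | left => exact (Computable.fst.comp (Computable.unpair.comp Computable.snd)).partrec
  | right => exact (Computable.snd.comp (Computable.unpair.comp Computable.snd)).partrec
  | oracle =>
    refine Partrec.of_eq (f := fun p : List Bool × ℕ =>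
      (((p.1[p.2]?).map fun b => cond b 1 0 : Option ℕ) : Part ℕ)) ?_
        fun p => (strOracle_eq _ _).symm
    apply Computable.ofOption
    exact Computable.option_map (Computable.list_getElem?.comp Computable.fst Computable.snd)
      (Computable.cond Computable.snd (Computable.const 1) (Computable.const 0)).to₂
  | pair c d h₁ h₂ =>
    have h₁' : Partrec fun p : List Bool × ℕ => c.eval (strOracle p.1) p.2 := h₁
    have h₂' : Partrec fun p : List Bool × ℕ => d.eval (strOracle p.1) p.2 := h₂
    refine Partrec.of_eq (h₁'.bind (g := fun p a =>
      (d.eval (strOracle p.1) p.2).map fun b => Nat.pair a b) ?_) fun p => (eval_pair _ _ _ _).symm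
    refine Partrec.to₂ (f := fun q : (List Bool × ℕ) × ℕ =>
      (d.eval (strOracle q.1.1) q.1.2).map fun b => Nat.pair q.2 b) ?_
    refine Partrec.map (h₂'.comp Computable.fst) ?_
    exact (Primrec₂.natPair.comp (Primrec.snd.comp Primrec.fst) Primrec.snd).to_comp.to₂
  | comp c d h₁ h₂ =>
    have h₁' : Partrec fun p : List Bool × ℕ => c.eval (strOracle p.1) p.2 := h₁
    have h₂' : Partrec fun p : List Bool × ℕ => d.eval (strOracle p.1) p.2 := h₂
    refine Partrec.of_eq (h₂'.bind (g := fun p a => c.eval (strOracle p.1) a) ?_)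
      fun p => (eval_comp _ _ _ _).symm
    exact (h₁'.comp (Computable.pair (Computable.fst.comp Computable.fst) Computable.snd)).to₂
  | prec c d h₁ h₂ =>
    have h₁' : Partrec fun p : List Bool × ℕ => c.eval (strOracle p.1) p.2 := h₁
    have h₂' : Partrec fun p : List Bool × ℕ => d.eval (strOracle p.1) p.2 := h₂
    have hu : Computable fun p : List Bool × ℕ => p.2.unpair :=
      Computable.unpair.comp Computable.snd
    refine Partrec.of_eq (Partrec.nat_rec (f := fun p : List Bool × ℕ => p.2.unpair.2)
      (g := fun p => c.eval (strOracle p.1) p.2.unpair.1)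
      (h := fun p q => d.eval (strOracle p.1) (Nat.pair p.2.unpair.1 (Nat.pair q.1 q.2)))
      (Computable.snd.comp hu)
      (h₁'.comp (Computable.pair Computable.fst (Computable.fst.comp hu))) ?_)
      fun p => (evalPrec _ _ _ _).symm
    refine Partrec.to₂ (f := fun r : (List Bool × ℕ) × (ℕ × ℕ) =>
      d.eval (strOracle r.1.1) (Nat.pair r.1.2.unpair.1 (Nat.pair r.2.1 r.2.2))) ?_
    have hf : Primrec fun r : (List Bool × ℕ) × (ℕ × ℕ) =>
        (r.1.1, Nat.pair r.1.2.unpair.1 (Nat.pair r.2.1 r.2.2)) :=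
      Primrec.pair (Primrec.fst.comp Primrec.fst)
        (Primrec₂.natPair.comp
          (Primrec.fst.comp (Primrec.unpair.comp (Primrec.snd.comp Primrec.fst)))
          (Primrec₂.natPair.comp (Primrec.fst.comp Primrec.snd) (Primrec.snd.comp Primrec.snd)))
    exact h₂'.comp hf.to_comp
  | rfind' c h =>
    have h' : Partrec fun p : List Bool × ℕ => c.eval (strOracle p.1) p.2 := h
    have hu : Computable fun p : List Bool × ℕ => p.2.unpair :=
      Computable.unpair.comp Computable.snd
    refine Partrec.of_eq (Partrec.map (Partrec.rfind
      (p := fun (p : List Bool × ℕ) n => (c.eval (strOracle p.1)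
        (Nat.pair p.2.unpair.1 (n + p.2.unpair.2))).map fun m => decide (m = 0)) ?_)
      (g := fun p m => m + p.2.unpair.2) ?_) fun p => (eval_rfind _ _ _).symm
    · refine Partrec.to₂ (f := fun r : (List Bool × ℕ) × ℕ => (c.eval (strOracle r.1.1)
        (Nat.pair r.1.2.unpair.1 (r.2 + r.1.2.unpair.2))).map fun m => decide (m = 0)) ?_
      have hf : Primrec fun r : (List Bool × ℕ) × ℕ =>
          (r.1.1, Nat.pair r.1.2.unpair.1 (r.2 + r.1.2.unpair.2)) :=
        Primrec.pair (Primrec.fst.comp Primrec.fst)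
          (Primrec₂.natPair.comp
            (Primrec.fst.comp (Primrec.unpair.comp (Primrec.snd.comp Primrec.fst)))
            (Primrec.nat_add.comp Primrec.snd
              (Primrec.snd.comp (Primrec.unpair.comp (Primrec.snd.comp Primrec.fst)))))
      refine Partrec.map (h'.comp hf.to_comp) ?_
      exact (Primrec.eq.decide.comp Primrec.snd (Primrec.const 0)).to_comp.to₂
    · exact (Primrec.nat_add.to_comp.comp Computable.snd
            ((Computable.snd.comp hu).comp Computable.fst)).to₂

theorem eval_mono {g g' : ℕ →. ℕ} (H : ∀ n, ∀ v ∈ g n, v ∈ g' n) (c : OracleCode) :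
    ∀ n, ∀ v ∈ c.eval g n, v ∈ c.eval g' n := by
  induction c with
  | zero => exact fun n v h => h
  | succ => exact fun n v h => h
  | left => exact fun n v h => h
  | right => exact fun n v h => h
  | oracle => exact H
  | pair c d h₁ h₂ =>
    intro n v h
    rw [eval_pair] at h ⊢
    simp only [Part.mem_bind_iff, Part.mem_map_iff] at h ⊢
    obtain ⟨a, ha, b, hb, rfl⟩ := h
    exact ⟨a, h₁ _ _ ha, b, h₂ _ _ hb, rfl⟩
  | comp c d h₁ h₂ =>
    intro n v h
    rw [eval_comp, Part.mem_bind_iff] at h ⊢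
    obtain ⟨a, ha, hb⟩ := h
    exact ⟨a, h₂ _ _ ha, h₁ _ _ hb⟩
  | prec c d h₁ h₂ =>
    intro n
    rw [← Nat.pair_unpair n]
    generalize n.unpair.1 = a
    induction n.unpair.2 with
    | zero => rw [evalPrec_zero, evalPrec_zero]; exact h₁ _
    | succ k ih =>
      intro v h
      rw [evalPrec_succ, Part.mem_bind_iff] at h ⊢
      obtain ⟨a, ha, hv⟩ := h
      exact ⟨a, ih a ha, h₂ _ _ hv⟩
  | rfind' c h =>
    intro n v hv
    rw [mem_eval_rfind] at hv ⊢
    obtain ⟨a, h0, hlt, rfl⟩ := hv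
    refine ⟨a, h _ _ h0, fun k hk => ?_, rfl⟩
    obtain ⟨y, hy, hy0⟩ := hlt k hk
    exact ⟨y, h _ _ hy, hy0⟩

/-- The initial segment of `X` of length `k`. -/
def pre (X : ℕ → Bool) (k : ℕ) : List Bool := (List.range k).map X

@[simp] theorem length_pre (X : ℕ → Bool) (k : ℕ) : (pre X k).length = k := by simp [pre]

theorem getElem?_pre {X : ℕ → Bool} {k n : ℕ} (h : n < k) : (pre X k)[n]? = some (X n) := by
  simp [pre, h]

theorem pre_mono (X : ℕ → Bool) {k l : ℕ} (h : k ≤ l) : pre X k <+: pre X l := by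
  obtain ⟨d, rfl⟩ := Nat.exists_eq_add_of_le h
  simp [pre, List.range_add]

theorem pre_succ (X : ℕ → Bool) (k : ℕ) : pre X (k + 1) = pre X k ++ [X k] := by
  simp [pre, List.range_succ]

theorem extendsStr_iff {X : ℕ → Bool} {σ : List Bool} : extendsStr X σ ↔ σ = pre X σ.length := by
  constructor
  · intro h
    apply List.ext_getElem (by simp)
    intro i h1 h2
    have := h ⟨i, h1⟩
    simp [pre] at this ⊢
    exact this.symm
  · intro h i
    have : σ[i.1]? = some (X i.1) := by
      have := getElem?_pre (X := X) i.2
      rwa [← h] at this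
    rw [List.getElem?_eq_getElem i.2] at this
    simpa using this.symm

theorem strOracle_mono {τ τ' : List Bool} (h : τ <+: τ') :
    ∀ n, ∀ v ∈ strOracle τ n, v ∈ strOracle τ' n := by
  intro n v hv
  obtain ⟨ρ, rfl⟩ := h
  rw [strOracle_eq] at hv ⊢
  simp only [Part.mem_ofOption, Option.mem_def, Option.map_eq_some_iff] at hv ⊢
  obtain ⟨b, hb, rfl⟩ := hv
  refine ⟨b, ?_, rfl⟩
  obtain ⟨hn, _⟩ := List.getElem?_eq_some_iff.1 hb
  rw [List.getElem?_append_left hn, hb]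

theorem strOracle_chi (X : ℕ → Bool) (k : ℕ) :
    ∀ n, ∀ v ∈ strOracle (pre X k) n, v ∈ chi X n := by
  intro n v hv
  rw [strOracle_eq] at hv
  simp only [Part.mem_ofOption, Option.mem_def, Option.map_eq_some_iff] at hv
  obtain ⟨b, hb, rfl⟩ := hv
  obtain ⟨hn, _⟩ := List.getElem?_eq_some_iff.1 hb
  rw [getElem?_pre (by simpa using hn)] at hb
  cases hb
  simp [chi]

/-- The use principle. -/
theorem eval_use (X : ℕ → Bool) (c : OracleCode) :
    ∀ n, ∀ v ∈ c.eval (chi X) n, ∃ k, v ∈ c.eval (strOracle (pre X k)) n := by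
  have lift : ∀ (c : OracleCode) {k l n v}, v ∈ c.eval (strOracle (pre X k)) n → k ≤ l →
      v ∈ c.eval (strOracle (pre X l)) n := fun c {k l n v} h hkl =>
    eval_mono (strOracle_mono (pre_mono X hkl)) c _ _ h
  induction c with
  | zero => exact fun n v h => ⟨0, h⟩
  | succ => exact fun n v h => ⟨0, h⟩
  | left => exact fun n v h => ⟨0, h⟩
  | right => exact fun n v h => ⟨0, h⟩
  | oracle =>
    intro n v h
    refine ⟨n + 1, ?_⟩
    simp only [OracleCode.eval] at h ⊢
    rw [strOracle_eq, getElem?_pre (Nat.lt_succ_self n)]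
    simpa [chi] using h
  | pair c d h₁ h₂ =>
    intro n v h
    rw [eval_pair] at h
    simp only [Part.mem_bind_iff, Part.mem_map_iff] at h
    obtain ⟨a, ha, b, hb, rfl⟩ := h
    obtain ⟨k, hk⟩ := h₁ _ _ ha
    obtain ⟨l, hl⟩ := h₂ _ _ hb
    refine ⟨max k l, ?_⟩
    rw [eval_pair]
    simp only [Part.mem_bind_iff, Part.mem_map_iff]
    exact ⟨a, lift c hk (le_max_left _ _), b, lift d hl (le_max_right _ _), rfl⟩
  | comp c d h₁ h₂ =>
    intro n v h
    rw [eval_comp, Part.mem_bind_iff] at h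
    obtain ⟨a, ha, hb⟩ := h
    obtain ⟨k, hk⟩ := h₂ _ _ ha
    obtain ⟨l, hl⟩ := h₁ _ _ hb
    refine ⟨max k l, ?_⟩
    rw [eval_comp, Part.mem_bind_iff]
    exact ⟨a, lift d hk (le_max_left _ _), lift c hl (le_max_right _ _)⟩
  | prec c d h₁ h₂ =>
    intro n
    rw [← Nat.pair_unpair n]
    generalize n.unpair.1 = a
    induction n.unpair.2 with
    | zero =>
      intro v h
      rw [evalPrec_zero] at h
      obtain ⟨k, hk⟩ := h₁ _ _ h
      exact ⟨k, by rwa [evalPrec_zero]⟩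
    | succ m ih =>
      intro v h
      rw [evalPrec_succ, Part.mem_bind_iff] at h
      obtain ⟨b, hb, hv⟩ := h
      obtain ⟨k, hk⟩ := ih _ hb
      obtain ⟨l, hl⟩ := h₂ _ _ hv
      refine ⟨max k l, ?_⟩
      rw [evalPrec_succ, Part.mem_bind_iff]
      exact ⟨b, lift (.prec c d) hk (le_max_left k l), lift d hl (le_max_right k l)⟩
  | rfind' c h =>
    intro n v hv
    rw [mem_eval_rfind] at hv
    obtain ⟨a, h0, hlt, rfl⟩ := hv
    obtain ⟨k, hk⟩ := h _ _ h0
    have : ∀ b ≤ a, ∃ k, ∀ m, m < b → ∃ y ∈ c.eval (strOracle (pre X k))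
        (Nat.pair n.unpair.1 (m + n.unpair.2)), y ≠ 0 := by
      intro b
      induction b with
      | zero => exact fun _ => ⟨0, fun m hm => absurd hm (Nat.not_lt_zero m)⟩
      | succ b ih =>
        intro hb
        obtain ⟨k, hk⟩ := ih (by omega)
        obtain ⟨y, hy, hy0⟩ := hlt b (by omega)
        obtain ⟨l, hl⟩ := h _ _ hy
        refine ⟨max k l, fun m hm => ?_⟩
        rcases Nat.lt_succ_iff_lt_or_eq.1 hm with hm | rfl
        · obtain ⟨z, hz, hz0⟩ := hk m hm
          exact ⟨z, lift c hz (le_max_left _ _), hz0⟩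
        · exact ⟨y, lift c hl (le_max_right _ _), hy0⟩
    obtain ⟨l, hl⟩ := this a le_rfl
    refine ⟨max k l, ?_⟩
    rw [mem_eval_rfind]
    refine ⟨a, lift c hk (le_max_left _ _), fun m hm => ?_, rfl⟩
    obtain ⟨y, hy, hy0⟩ := hl m hm
    exact ⟨y, lift c hy (le_max_right _ _), hy0⟩

/-! ### The halting problem decides c.e. predicates -/

theorem encodeCode_injective : Function.Injective OracleCode.encodeCode := by
  intro c
  induction c with
  | zero | succ | left | right | oracle =>
    intro d h
    cases d <;> simp only [OracleCode.encodeCode] at h <;> first | rfl | omega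
  | pair c d h₁ h₂ | comp c d h₁ h₂ | prec c d h₁ h₂ =>
    intro e h
    cases e <;> simp only [OracleCode.encodeCode] at h <;> try omega
    rename_i a b
    have := Nat.pair_eq_pair.1 (show Nat.pair c.encodeCode d.encodeCode
      = Nat.pair a.encodeCode b.encodeCode by omega)
    rw [h₁ this.1, h₂ this.2]
  | rfind' c h₁ =>
    intro e h
    cases e <;> simp only [OracleCode.encodeCode] at h <;> try omega
    rename_i a
    have := Nat.pair_eq_pair.1 (show Nat.pair c.encodeCode c.encodeCode
      = Nat.pair a.encodeCode a.encodeCode by omega)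
    rw [h₁ this.1]

/-- Code of a constant function. -/
def constC : ℕ → OracleCode
  | 0 => .zero
  | n + 1 => .comp .succ (constC n)

theorem eval_constC (g : ℕ →. ℕ) (x n : ℕ) : (constC x).eval g n = Part.some x := by
  induction x with
  | zero => rfl
  | succ x ih =>
    rw [constC, eval_comp, ih, Part.bind_some]
    rfl

theorem encode_constC_primrec : Primrec fun x => (constC x).encodeCode := by
  refine (Primrec.nat_rec' (f := fun x : ℕ => x) (g := fun _ : ℕ => 0)
    (h := fun _ (q : ℕ × ℕ) => 4 * Nat.pair 1 q.2 + 6) Primrec.id (Primrec.const 0) ?_).of_eq ?_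
  · exact (Primrec.nat_add.comp (Primrec.nat_mul.comp (Primrec.const 4)
      (Primrec₂.natPair.comp (Primrec.const 1) (Primrec.snd.comp Primrec.snd)))
      (Primrec.const 6)).to₂
  · intro x
    induction x with
    | zero => rfl
    | succ x ih => simp only [constC, OracleCode.encodeCode, ← ih]

theorem zeroJump_decides {h : ℕ →. ℕ} (hh : Nat.Partrec h) :
    ∃ q : ℕ → ℕ, Primrec q ∧ ∀ x, zeroJump (q x) = true ↔ (h x).Dom := by
  obtain ⟨C, hC⟩ := redIn_of_partrec (g := chi fun _ => false) hh
  refine ⟨fun x => (OracleCode.comp C (constC x)).encodeCode, ?_, fun x => ?_⟩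
  · exact Primrec.nat_add.comp (Primrec.nat_mul.comp (Primrec.const 4)
      (Primrec₂.natPair.comp (Primrec.const _) encode_constC_primrec)) (Primrec.const 6)
  · have ev : ∀ n, (OracleCode.comp C (constC x)).eval (chi fun _ => false) n = h x := by
      intro n
      rw [eval_comp, eval_constC, Part.bind_some, hC]
    unfold zeroJump jump
    simp only [decide_eq_true_iff]
    constructor
    · rintro ⟨c, hc, hd⟩
      rw [encodeCode_injective hc, ev] at hd
      exact hd
    · intro hd
      exact ⟨_, rfl, by rw [ev]; exact hd⟩

/-- Total functions computable from the oracle `g`. -/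
def TotRec (g : ℕ →. ℕ) (f : ℕ → ℕ) : Prop := Nat.RecursiveIn {g} (natFun f)

theorem TotRec.of_primrec {g : ℕ →. ℕ} {f : ℕ → ℕ} (h : Primrec f) : TotRec g f :=
  (Primrec.nat_iff.1 h).recursiveIn

theorem TotRec.comp {g : ℕ →. ℕ} {f h : ℕ → ℕ} (hf : TotRec g f) (hh : TotRec g h) :
    TotRec g fun n => f (h n) :=
  (Nat.RecursiveIn.comp hf hh).of_eq fun n => Part.bind_some (h n) (natFun f)

theorem TotRec.pair {g : ℕ →. ℕ} {f h : ℕ → ℕ} (hf : TotRec g f) (hh : TotRec g h) :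
    TotRec g fun n => Nat.pair (f n) (h n) :=
  (Nat.RecursiveIn.pair hf hh).of_eq fun n => by simp [natFun, Seq.seq]

theorem TotRec.chi (X : ℕ → Bool) : TotRec (chi X) fun n => cond (X n) 1 0 :=
  Nat.RecursiveIn.oracle _ rfl

theorem sigma_zeroJump {h : ℕ →. ℕ} (hh : Nat.Partrec h) {D : ℕ → Bool} (hD : Primrec D) :
    ∃ c : OracleCode, ∀ x, (c.eval (chi zeroJump) x).Dom ↔
      ∃ w, D (Nat.pair x w) = true ∧ ¬ (h (Nat.pair x w)).Dom := by
  obtain ⟨q, hq, hqs⟩ := zeroJump_decides hh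
  have hG : Primrec fun n : ℕ => cond (D n.unpair.1) n.unpair.2 1 :=
    Primrec.cond (hD.comp (Primrec.fst.comp Primrec.unpair))
      (Primrec.snd.comp Primrec.unpair) (Primrec.const 1)
  have h1 := (TotRec.of_primrec (g := chi zeroJump) hG).comp
    ((TotRec.of_primrec Primrec.id).pair ((TotRec.chi zeroJump).comp (TotRec.of_primrec hq)))
  obtain ⟨c, hc⟩ := redIn_of_recursiveIn h1.rfind
  refine ⟨c, fun x => ?_⟩
  have key2 : ∀ w, (cond (D (Nat.pair x w)) (cond (zeroJump (q (Nat.pair x w))) 1 0) 1 = 0) ↔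
      (D (Nat.pair x w) = true ∧ ¬ (h (Nat.pair x w)).Dom) := by
    intro w
    rw [← hqs]
    cases D (Nat.pair x w) <;> cases zeroJump (q (Nat.pair x w)) <;> simp
  simp only [← key2]
  rw [hc]
  refine Nat.rfind_dom.trans ?_
  simp [natFun]

/-! ### Measure of sets of strings -/

/-- The length-`n` strings having a prefix in `V`. -/
def hits (V : Set (List Bool)) (n : ℕ) : Set (Fin n → Bool) := {f | ∃ σ ∈ V, σ <+: List.ofFn f}

/-- Proportion of the length-`n` strings having a prefix in `V`. -/
noncomputable def prop (V : Set (List Bool)) (n : ℕ) : ℝ≥0∞ :=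
  (Nat.card (hits V n) : ℝ≥0∞) / 2 ^ n

theorem stringMeasure_eq (V : Set (List Bool)) : stringMeasure V = ⨆ n, prop V n := rfl

theorem prop_mono (V : Set (List Bool)) : Monotone (prop V) := by
  refine monotone_nat_of_le_succ fun n => ?_
  have h : Nat.card (hits V n) * 2 ≤ Nat.card (hits V (n + 1)) := by
    have h2 : Nat.card Bool = 2 := by simp
    rw [← h2, ← Nat.card_prod]
    let F : (hits V n) × Bool → hits V (n + 1) := fun p =>
      ⟨Fin.snoc p.1.1 p.2, by
        obtain ⟨σ, hσ, hp⟩ := p.1.2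
        refine ⟨σ, hσ, hp.trans ?_⟩
        rw [List.ofFn_succ']
        simp⟩
    refine Nat.card_le_card_of_injective F ?_
    rintro ⟨⟨f, hf⟩, b⟩ ⟨⟨g, hg⟩, c⟩ h
    have h' : (Fin.snoc f b : Fin (n + 1) → Bool) = Fin.snoc g c := congrArg Subtype.val h
    obtain ⟨h1, h2⟩ := Fin.snoc_injective2 h'
    subst h1; subst h2; rfl
  unfold prop
  rw [← ENNReal.mul_div_mul_right _ (2 ^ n) (c := 2) (by simp) (by simp), ← pow_succ]
  gcongr
  exact_mod_cast h

theorem count_hits (V : Set (List Bool)) (n : ℕ) :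
    (Nat.card (hits V n) : ℝ≥0∞) = MeasureTheory.Measure.count (hits V n) := by
  rw [MeasureTheory.Measure.count_apply_finite _ (Set.toFinite _), Nat.card_coe_set_eq,
    Set.ncard_eq_toFinset_card _ (Set.toFinite _)]

theorem stringMeasure_iUnion_le (V : ℕ → Set (List Bool)) :
    stringMeasure (⋃ i, V i) ≤ ∑' i, stringMeasure (V i) := by
  rw [stringMeasure_eq]
  refine iSup_le fun n => ?_
  have : prop (⋃ i, V i) n ≤ ∑' i, prop (V i) n := by
    unfold prop
    simp only [div_eq_mul_inv]
    rw [ENNReal.tsum_mul_right]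
    gcongr
    simp only [count_hits]
    refine le_trans (MeasureTheory.measure_mono ?_) (MeasureTheory.measure_iUnion_le _)
    rintro f ⟨σ, hσ, hp⟩
    obtain ⟨i, hi⟩ := Set.mem_iUnion.1 hσ
    exact Set.mem_iUnion.2 ⟨i, σ, hi, hp⟩
  exact this.trans (ENNReal.tsum_le_tsum fun i => le_iSup (prop (V i)) n)

theorem stringMeasure_empty : stringMeasure ∅ = 0 := by
  rw [stringMeasure_eq]
  simp [prop, hits]

theorem stringMeasure_mono {V W : Set (List Bool)} (h : V ⊆ W) :
    stringMeasure V ≤ stringMeasure W := by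
  rw [stringMeasure_eq, stringMeasure_eq]
  refine iSup_mono fun n => ?_
  unfold prop
  gcongr
  refine Nat.card_mono (Set.toFinite _) ?_
  rintro f ⟨σ, hσ, hp⟩
  exact ⟨σ, h hσ, hp⟩

/-- Upward closed sets of strings. -/
def UpC (V : Set (List Bool)) : Prop := ∀ σ ∈ V, ∀ τ, σ <+: τ → τ ∈ V

theorem UpC.hits_eq {V : Set (List Bool)} (h : UpC V) (n : ℕ) :
    hits V n = {f | List.ofFn f ∈ V} := by
  ext f
  constructor
  · rintro ⟨σ, hσ, hp⟩
    exact h _ hσ _ hp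
  · intro hf
    exact ⟨_, hf, List.prefix_rfl⟩

theorem stringMeasure_add_le {V W Z : Set (List Bool)} (hV : UpC V) (hW : UpC W)
    (hd : ∀ σ ∈ V, σ ∉ W) (hVZ : V ⊆ Z) (hWZ : W ⊆ Z) :
    stringMeasure V + stringMeasure W ≤ stringMeasure Z := by
  rw [stringMeasure_eq, stringMeasure_eq,
    ENNReal.iSup_add_iSup_of_monotone (prop_mono V) (prop_mono W)]
  refine iSup_le fun n => le_trans ?_ (le_iSup (prop Z) n)
  unfold prop
  rw [← ENNReal.add_div]
  gcongr
  simp only [count_hits]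
  rw [← MeasureTheory.measure_union _ (Set.Finite.measurableSet (Set.toFinite _))]
  · refine MeasureTheory.measure_mono ?_
    rintro f (⟨σ, hσ, hp⟩ | ⟨σ, hσ, hp⟩)
    · exact ⟨σ, hVZ hσ, hp⟩
    · exact ⟨σ, hWZ hσ, hp⟩
  · rw [hV.hits_eq, hW.hits_eq]
    exact Set.disjoint_left.2 fun f h1 h2 => hd _ h1 h2

theorem lt_mul_stringMeasure (V : Set (List Bool)) (a b : ℕ) :
    (a : ℝ≥0∞) < b * stringMeasure V ↔ ∃ n, a * 2 ^ n < b * Nat.card (hits V n) := by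
  rw [stringMeasure_eq, ENNReal.mul_iSup, lt_iSup_iff]
  refine exists_congr fun n => ?_
  unfold prop
  rw [← mul_div_assoc, ENNReal.lt_div_iff_mul_lt (by simp) (by simp)]
  exact_mod_cast Iff.rfl

/-- The list of all strings of length `n`. -/
def allStr : ℕ → List (List Bool)
  | 0 => [[]]
  | n + 1 => (allStr n).map (List.cons false) ++ (allStr n).map (List.cons true)

theorem mem_allStr {n : ℕ} {τ : List Bool} : τ ∈ allStr n ↔ τ.length = n := by
  induction n generalizing τ with
  | zero => simp [allStr]
  | succ n ih =>
    cases τ with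
    | nil => simp [allStr]
    | cons b τ => cases b <;> simp [allStr, ih]

theorem nodup_allStr (n : ℕ) : (allStr n).Nodup := by
  induction n with
  | zero => simp [allStr]
  | succ n ih =>
    refine List.Nodup.append (ih.map ?_) (ih.map ?_) ?_
    · exact List.cons_injective
    · exact List.cons_injective
    · intro l h1 h2
      simp only [List.mem_map] at h1 h2
      obtain ⟨a, _, rfl⟩ := h1
      obtain ⟨b, _, hb⟩ := h2
      simp at hb

theorem card_filter_allStr (n : ℕ) (p : List Bool → Bool) :
    ((allStr n).filter p).length = Nat.card {f : Fin n → Bool | p (List.ofFn f) = true} := by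
  rw [← List.toFinset_card_of_nodup ((nodup_allStr n).filter p), ← Nat.card_eq_finsetCard]
  symm
  let F : {f : Fin n → Bool | p (List.ofFn f) = true} → ((allStr n).filter p).toFinset :=
    fun f => ⟨List.ofFn f.1, by
      have := f.2
      simp only [Set.mem_setOf_eq] at this
      simp [mem_allStr, this]⟩
  refine Nat.card_eq_of_bijective F ⟨?_, ?_⟩
  · intro f g h
    have h' : List.ofFn f.1 = List.ofFn g.1 := congrArg Subtype.val h
    exact Subtype.ext (List.ofFn_injective h')
  · rintro ⟨l, hl⟩
    have hl' := hl
    simp only [List.mem_toFinset, List.mem_filter, mem_allStr] at hl'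
    obtain ⟨rfl, h2⟩ := hl'
    exact ⟨⟨l.get, by simpa using h2⟩, Subtype.ext (List.ofFn_get l)⟩

theorem primrec_exists_lt {α : Type*} [Primcodable α] {R : ℕ → α → Prop} (h : PrimrecRel R) :
    PrimrecRel fun n y => ∃ x < n, R x y :=
  ((PrimrecRel.exists_mem_list h).comp (Primrec.list_range.comp Primrec.fst)
    Primrec.snd).of_eq fun p => by simp

theorem primrec_forall_lt {α : Type*} [Primcodable α] {R : ℕ → α → Prop} (h : PrimrecRel R) :
    PrimrecRel fun n y => ∀ x < n, R x y :=
  ((PrimrecRel.forall_mem_list h).comp (Primrec.list_range.comp Primrec.fst)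
    Primrec.snd).of_eq fun p => by simp

theorem allStr_primrec : Primrec allStr := by
  refine (Primrec.nat_rec' (f := fun x : ℕ => x) (g := fun _ : ℕ => [[]])
    (h := fun _ (q : ℕ × List (List Bool)) =>
      q.2.map (List.cons false) ++ q.2.map (List.cons true)) Primrec.id (Primrec.const _) ?_).of_eq ?_
  · have h2 : Primrec fun r : ℕ × (ℕ × List (List Bool)) => r.2.2 :=
      Primrec.snd.comp Primrec.snd
    exact (Primrec.list_append.comp
      (Primrec.list_map h2 (Primrec.list_cons.comp (Primrec.const false) Primrec.snd).to₂)
      (Primrec.list_map h2 (Primrec.list_cons.comp (Primrec.const true) Primrec.snd).to₂)).to₂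
  · intro x
    induction x with
    | zero => rfl
    | succ x ih => simp only [allStr, ← ih]

section
open Nat.Partrec (Code)
open Nat.Partrec.Code (evaln)

/-! ### Stage approximations to the measures of preimages -/

/-- `E` simulates `C` on string oracles. -/
def Sim (E : Code) (C : OracleCode) : Prop :=
  ∀ (τ : List Bool) (n : ℕ), E.eval (Nat.pair (Encodable.encode τ) n) = C.eval (strOracle τ) n

theorem exists_sim (C : OracleCode) : ∃ E : Code, Sim E C := by
  have h1 : Partrec fun p : List Bool × ℕ => C.eval (strOracle p.1) p.2 := eval_str_partrec C
  have h2 : Partrec fun x : ℕ =>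
      ((Encodable.decode (α := List Bool) x.unpair.1 : Option (List Bool)) : Part (List Bool)).bind
        fun τ => C.eval (strOracle τ) x.unpair.2 := by
    refine Partrec.bind ?_ ?_
    · exact Computable.ofOption (Computable.decode.comp
        (Computable.fst.comp Computable.unpair))
    · exact (h1.comp (Computable.pair Computable.snd
        (Computable.snd.comp (Computable.unpair.comp Computable.fst)))).to₂
  obtain ⟨E, hE⟩ := Code.exists_code.1 (Partrec.nat_iff.1 h2)
  refine ⟨E, fun τ n => ?_⟩
  rw [hE]
  simp

/-- Strings `τ` such that `C` with oracle `τ` outputs `σ`. -/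
def US (C : OracleCode) (σ : List Bool) : Set (List Bool) :=
  {τ | ∀ i b, σ[i]? = some b → cond b 1 0 ∈ C.eval (strOracle τ) i}

theorem US_upC (C : OracleCode) (σ : List Bool) : UpC (US C σ) := fun _ hτ _ hp i b hb =>
  eval_mono (strOracle_mono hp) C _ _ (hτ i b hb)

theorem US_anti (C : OracleCode) {ρ σ : List Bool} (h : ρ <+: σ) : US C σ ⊆ US C ρ := by
  intro τ hτ i b hb
  refine hτ i b ?_
  obtain ⟨x, rfl⟩ := h
  obtain ⟨hn, _⟩ := List.getElem?_eq_some_iff.1 hb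
  rw [List.getElem?_append_left hn, hb]

theorem US_disjoint (C : OracleCode) {σ σ' : List Bool} (hl : σ.length = σ'.length) (hne : σ ≠ σ') :
    ∀ τ ∈ US C σ, τ ∉ US C σ' := by
  intro τ h h'
  apply hne
  apply List.ext_getElem hl
  intro i h1 h2
  have e := Part.mem_unique (h i _ (List.getElem?_eq_getElem h1))
    (h' i _ (List.getElem?_eq_getElem h2))
  revert e
  cases σ[i] <;> cases σ'[i] <;> simp

/-- Stage `k` approximation to `US`. -/
def Ust (E : Code) (k : ℕ) (σ τ : List Bool) : Prop :=
  ∀ i < σ.length, evaln k E (Nat.pair (Encodable.encode τ) i) = (σ[i]?).map fun b => cond b 1 0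

instance (E : Code) (k : ℕ) (σ τ : List Bool) : Decidable (Ust E k σ τ) := by
  unfold Ust; infer_instance

theorem Ust_mono {E : Code} {k l : ℕ} (h : k ≤ l) {σ τ : List Bool} (H : Ust E k σ τ) :
    Ust E l σ τ := by
  intro i hi
  have := H i hi
  rw [List.getElem?_eq_getElem hi] at this ⊢
  exact Code.evaln_mono h this

theorem exists_Ust {E : Code} {C : OracleCode} (hE : Sim E C) {σ τ : List Bool} :
    (∃ k, Ust E k σ τ) ↔ τ ∈ US C σ := by
  constructor
  · rintro ⟨k, hk⟩ i b hb
    obtain ⟨hn, _⟩ := List.getElem?_eq_some_iff.1 hb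
    have := hk i hn
    rw [hb] at this
    rw [← hE]
    exact Code.evaln_sound this
  · intro h
    have : ∀ m ≤ σ.length, ∃ k, ∀ i < m, evaln k E (Nat.pair (Encodable.encode τ) i) =
        (σ[i]?).map fun b => cond b 1 0 := by
      intro m
      induction m with
      | zero => exact fun _ => ⟨0, fun i hi => absurd hi (Nat.not_lt_zero i)⟩
      | succ m ih =>
        intro hm
        obtain ⟨k, hk⟩ := ih (by omega)
        have h1 := h m _ (List.getElem?_eq_getElem (by omega))
        rw [← hE] at h1
        obtain ⟨l, hl⟩ := Code.evaln_complete.1 h1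
        refine ⟨max k l, fun i hi => ?_⟩
        rcases Nat.lt_succ_iff_lt_or_eq.1 hi with hi | rfl
        · have := hk i hi
          rw [List.getElem?_eq_getElem (by omega)] at this ⊢
          exact Code.evaln_mono (le_max_left _ _) this
        · rw [List.getElem?_eq_getElem (by omega)]
          exact Code.evaln_mono (le_max_right _ _) hl
    exact this _ le_rfl

theorem Ust_primrec (E : Code) : PrimrecPred fun p : ℕ × List Bool × List Bool =>
    Ust E p.1 p.2.1 p.2.2 := by
  have h : PrimrecRel fun (i : ℕ) (p : ℕ × List Bool × List Bool) =>
      evaln p.1 E (Nat.pair (Encodable.encode p.2.2) i) =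
        (p.2.1[i]?).map fun b => cond b 1 0 := by
    refine Primrec.eq.comp ?_ ?_
    · exact Code.primrec_evaln.comp (Primrec.pair (Primrec.pair (Primrec.fst.comp Primrec.snd)
        (Primrec.const E)) (Primrec₂.natPair.comp (Primrec.encode.comp
          (Primrec.snd.comp (Primrec.snd.comp Primrec.snd))) Primrec.fst))
    · exact Primrec.option_map (Primrec.list_getElem?.comp
        (Primrec.fst.comp (Primrec.snd.comp Primrec.snd)) Primrec.fst)
        (Primrec.cond Primrec.snd (Primrec.const 1) (Primrec.const 0)).to₂
  exact ((primrec_forall_lt h).comp (Primrec.list_length.comp (Primrec.fst.comp Primrec.snd))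
    Primrec.id)

/-- Stage count. -/
def Cnt (E : Code) (k : ℕ) (σ : List Bool) (n : ℕ) : ℕ :=
  ((allStr n).filter fun τ => decide (Ust E k σ τ)).length

theorem Cnt_primrec (E : Code) : Primrec fun p : ℕ × List Bool × ℕ => Cnt E p.1 p.2.1 p.2.2 := by
  have h : PrimrecRel fun (τ : List Bool) (p : ℕ × List Bool × ℕ) => Ust E p.1 p.2.1 τ :=
    (Ust_primrec E).comp (Primrec.pair (Primrec.fst.comp Primrec.snd)
      (Primrec.pair (Primrec.fst.comp (Primrec.snd.comp Primrec.snd)) Primrec.fst))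
  exact Primrec.list_length.comp (h.listFilter.comp
    (allStr_primrec.comp (Primrec.snd.comp Primrec.snd)) Primrec.id)

theorem Cnt_le {E : Code} {C : OracleCode} (hE : Sim E C) (k : ℕ) (σ : List Bool) (n : ℕ) :
    Cnt E k σ n ≤ Nat.card (hits (US C σ) n) := by
  rw [Cnt, card_filter_allStr]
  refine Nat.card_mono (Set.toFinite _) ?_
  intro f hf
  rw [(US_upC C σ).hits_eq]
  exact (exists_Ust hE).1 ⟨k, by simpa using hf⟩

theorem exists_Cnt {E : Code} {C : OracleCode} (hE : Sim E C) (σ : List Bool) (n : ℕ) :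
    ∃ k, Cnt E k σ n = Nat.card (hits (US C σ) n) := by
  have h : ∀ f : Fin n → Bool, ∃ k, List.ofFn f ∈ US C σ → Ust E k σ (List.ofFn f) := by
    intro f
    by_cases hf : List.ofFn f ∈ US C σ
    · obtain ⟨k, hk⟩ := (exists_Ust hE).2 hf
      exact ⟨k, fun _ => hk⟩
    · exact ⟨0, fun h => absurd h hf⟩
  choose K hK using h
  refine ⟨Finset.univ.sup K, le_antisymm (Cnt_le hE _ _ _) ?_⟩
  rw [Cnt, card_filter_allStr]
  refine Nat.card_mono (Set.toFinite _) ?_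
  intro f hf
  rw [(US_upC C σ).hits_eq] at hf
  simpa using Ust_mono (Finset.le_sup (Finset.mem_univ f)) (hK f hf)

/-- Stage `k` test for `a < b * λ(σ)`. -/
def Lam (E : Code) (σ : List Bool) (a b k : ℕ) : Prop :=
  ∃ w < k, a * 2 ^ w.unpair.1 < b * Cnt E w.unpair.2 σ w.unpair.1

instance (E : Code) (σ : List Bool) (a b k : ℕ) : Decidable (Lam E σ a b k) := by
  unfold Lam; infer_instance

theorem Lam_mono {E : Code} {σ : List Bool} {a b k l : ℕ} (h : k ≤ l) (H : Lam E σ a b k) :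
    Lam E σ a b l := by
  obtain ⟨w, hw, h2⟩ := H
  exact ⟨w, by omega, h2⟩

theorem exists_Lam {E : Code} {C : OracleCode} (hE : Sim E C) {σ : List Bool} {a b : ℕ} :
    (∃ k, Lam E σ a b k) ↔ (a : ℝ≥0∞) < b * stringMeasure (US C σ) := by
  rw [lt_mul_stringMeasure]
  constructor
  · rintro ⟨k, w, _, hw⟩
    exact ⟨_, hw.trans_le (Nat.mul_le_mul_left _ (Cnt_le hE _ _ _))⟩
  · rintro ⟨n, hn⟩
    obtain ⟨l, hl⟩ := exists_Cnt hE σ n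
    refine ⟨Nat.pair n l + 1, Nat.pair n l, Nat.lt_succ_self _, ?_⟩
    simpa [hl] using hn

theorem pow_two_primrec : Primrec fun n : ℕ => 2 ^ n := by
  refine (Primrec.nat_rec' (f := fun x : ℕ => x) (g := fun _ : ℕ => 1)
    (h := fun _ (q : ℕ × ℕ) => q.2 * 2) Primrec.id (Primrec.const 1) ?_).of_eq ?_
  · exact (Primrec.nat_mul.comp (Primrec.snd.comp Primrec.snd) (Primrec.const 2)).to₂
  · intro x
    induction x with
    | zero => rfl
    | succ x ih => simp only [pow_succ, ← ih]

theorem Lam_primrec (E : Code) : PrimrecPred fun p : (List Bool × ℕ × ℕ) × ℕ =>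
    Lam E p.1.1 p.1.2.1 p.1.2.2 p.2 := by
  have h : PrimrecRel fun (w : ℕ) (p : List Bool × ℕ × ℕ) =>
      p.2.1 * 2 ^ w.unpair.1 < p.2.2 * Cnt E w.unpair.2 p.1 w.unpair.1 := by
    refine Primrec.nat_lt.comp ?_ ?_
    · exact Primrec.nat_mul.comp (Primrec.fst.comp (Primrec.snd.comp Primrec.snd))
        (pow_two_primrec.comp (Primrec.fst.comp (Primrec.unpair.comp Primrec.fst)))
    · exact Primrec.nat_mul.comp (Primrec.snd.comp (Primrec.snd.comp Primrec.snd))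
        ((Cnt_primrec E).comp (Primrec.pair (Primrec.snd.comp (Primrec.unpair.comp Primrec.fst))
          (Primrec.pair (Primrec.fst.comp Primrec.snd)
            (Primrec.fst.comp (Primrec.unpair.comp Primrec.fst)))))
  exact (primrec_exists_lt h).comp Primrec.snd Primrec.fst

/-! ### Preimages of a noncomputable sequence have measure tending to zero -/

theorem stringMeasure_le_one (V : Set (List Bool)) : stringMeasure V ≤ 1 := by
  rw [stringMeasure_eq]
  refine iSup_le fun n => ?_
  unfold prop
  refine ENNReal.div_le_of_le_mul ?_
  have h : Nat.card (hits V n) ≤ 2 ^ n := by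
    have := Nat.card_mono (Set.toFinite Set.univ) (Set.subset_univ (hits V n))
    simpa using this
  rw [one_mul]
  exact_mod_cast h

theorem search_partrec {v : ℕ → ℕ} {T : ℕ × ℕ → Bool} {o : ℕ × ℕ → ℕ} (hT : Primrec T)
    (ho : Primrec o) (h1 : ∀ n, ∃ w, T (n, w) = true)
    (h2 : ∀ n w, T (n, w) = true → o (n, w) = v n) : Nat.Partrec (natFun v) := by
  have hp : Partrec fun n : ℕ => (Nat.rfind fun w => Part.some (T (n, w))).map fun w => o (n, w) := by
    refine Partrec.map (Partrec.rfind ?_) ?_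
    · exact (hT.to_comp.to₂).partrec₂
    · exact ho.to_comp.to₂
  refine Nat.Partrec.of_eq (Partrec.nat_iff.1 hp) fun n => ?_
  have hd : (Nat.rfind fun w => Part.some (T (n, w))).Dom := by
    refine Nat.rfind_dom.2 ?_
    obtain ⟨w, hw⟩ := h1 n
    exact ⟨w, by simp [hw], fun _ => trivial⟩
  obtain ⟨w, hw⟩ := Part.dom_iff_mem.1 hd
  have := Nat.rfind_spec hw
  refine Part.eq_some_iff.2 (Part.mem_map_iff _ |>.2 ⟨w, hw, h2 n w ?_⟩)
  exact (Part.mem_some_iff.1 this).symm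

/-- The string with code `j`. -/
def strOf (j : ℕ) : List Bool := (Encodable.decode (α := List Bool) j).getD []

@[simp] theorem strOf_encode (σ : List Bool) : strOf (Encodable.encode σ) = σ := by simp [strOf]

theorem strOf_primrec : Primrec strOf :=
  Primrec.option_getD.comp Primrec.decode (Primrec.const [])

theorem list_take_primrec (n : ℕ) : Primrec fun σ : List Bool => σ.take n := by
  refine ((Primrec.listFilterMap (f := fun _ : List Bool => List.range n)
    (g := fun σ i => σ[i]?) (Primrec.const _) Primrec.list_getElem?)).of_eq fun σ => ?_
  induction n generalizing σ with
  | zero => simp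
  | succ n ih =>
    cases σ with
    | nil => simp
    | cons a σ => simp [List.range_succ_eq_map, List.filterMap_map, ih]

theorem lam_small {E : Code} {C : OracleCode} (hE : Sim E C) {B : ℕ → Bool}
    (hB : ¬ ComputableSeq B) (N : ℕ) : ∃ n, (N : ℝ≥0∞) * stringMeasure (US C (pre B n)) ≤ 1 := by
  by_contra! hN
  classical
  have hex : ∃ a : ℕ, ∃ n, (N : ℝ≥0∞) * stringMeasure (US C (pre B n)) ≤ a := by
    refine ⟨N, 0, ?_⟩
    calc (N : ℝ≥0∞) * stringMeasure (US C (pre B 0)) ≤ N * 1 := by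
          gcongr; exact stringMeasure_le_one _
      _ = N := mul_one _
  obtain ⟨n0, hn0⟩ := Nat.find_spec hex
  have hmin := fun m => Nat.find_min hex (m := m)
  generalize Nat.find hex = a0 at hn0 hmin
  have ha0 : 2 ≤ a0 := by
    by_contra! h
    have : (a0 : ℝ≥0∞) ≤ 1 := by exact_mod_cast (by omega : a0 ≤ 1)
    exact absurd (hn0.trans this) (not_le.2 (hN n0))
  obtain ⟨a, rfl⟩ : ∃ a, a0 = a + 1 := ⟨a0 - 1, by omega⟩
  have hlt : ∀ n, (a : ℝ≥0∞) < N * stringMeasure (US C (pre B n)) := by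
    intro n
    by_contra! h
    exact hmin a (by omega) ⟨n, h⟩
  have huniq : ∀ σ : List Bool, pre B n0 <+: σ →
      (a : ℝ≥0∞) < N * stringMeasure (US C σ) → σ = pre B σ.length := by
    intro σ hp hσ
    by_contra hne
    have hlen : n0 ≤ σ.length := by simpa using hp.length_le
    have := stringMeasure_add_le (US_upC C σ) (US_upC C (pre B σ.length))
      (US_disjoint C (by simp) hne) (US_anti C hp) (US_anti C (pre_mono B hlen))
    have h2 : (N : ℝ≥0∞) * stringMeasure (US C σ) + N * stringMeasure (US C (pre B σ.length))
        ≤ (a + 1 : ℕ) := by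
      rw [← mul_add]
      exact le_trans (by gcongr) hn0
    have h3 : (a : ℝ≥0∞) + a < (a + 1 : ℕ) :=
      (ENNReal.add_lt_add hσ (hlt _)).trans_le h2
    have h4 : a + a < a + 1 := by exact_mod_cast h3
    omega
  apply hB
  refine redIn_of_partrec ?_
  let T : ℕ × ℕ → Bool := fun p => decide ((strOf p.2.unpair.1).take n0 = pre B n0 ∧
    p.1 < (strOf p.2.unpair.1).length ∧ Lam E (strOf p.2.unpair.1) a N p.2.unpair.2)
  let o : ℕ × ℕ → ℕ := fun p => (((strOf p.2.unpair.1)[p.1]?).map fun b => cond b 1 0).getD 0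
  have hs : Primrec fun p : ℕ × ℕ => strOf p.2.unpair.1 :=
    strOf_primrec.comp (Primrec.fst.comp (Primrec.unpair.comp Primrec.snd))
  refine search_partrec (v := fun n => cond (B n) 1 0) (T := T) (o := o) ?_ ?_ ?_ ?_
  · refine PrimrecPred.decide (PrimrecPred.and ?_ (PrimrecPred.and ?_ ?_))
    · exact Primrec.eq.comp ((list_take_primrec n0).comp hs) (Primrec.const _)
    · exact Primrec.nat_lt.comp Primrec.fst (Primrec.list_length.comp hs)
    · exact (Lam_primrec E).comp (Primrec.pair (Primrec.pair hs (Primrec.const (a, N)))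
        (Primrec.snd.comp (Primrec.unpair.comp Primrec.snd)))
  · exact Primrec.option_getD.comp (Primrec.option_map
      (Primrec.list_getElem?.comp hs Primrec.fst)
      (Primrec.cond Primrec.snd (Primrec.const 1) (Primrec.const 0)).to₂) (Primrec.const 0)
  · intro n
    obtain ⟨k, hk⟩ := (exists_Lam hE).2 (hlt (n0 + (n + 1)))
    refine ⟨Nat.pair (Encodable.encode (pre B (n0 + (n + 1)))) k, ?_⟩
    simp only [T, Nat.unpair_pair, strOf_encode, decide_eq_true_iff, length_pre]
    refine ⟨?_, by omega, hk⟩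
    have := List.prefix_iff_eq_take.1 (pre_mono B (Nat.le_add_right n0 (n + 1)))
    simpa using this.symm
  · intro n w hw
    simp only [T, decide_eq_true_iff] at hw
    obtain ⟨h1, h2, h3⟩ := hw
    have := huniq _ (h1 ▸ List.take_prefix _ _) ((exists_Lam hE).1 ⟨_, h3⟩)
    simp only [o]
    rw [this, getElem?_pre h2]
    rfl

/-! ### The trial process -/

/-- The test ending the trial of the string with code `j` that was started at stage `m`. -/
def tst (E : Code) (c i j m s : ℕ) : Prop :=
  (∃ v < s, evaln s (Denumerable.ofNat Code i) (Nat.pair i m) = some v) ∨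
    Lam E (strOf j) 1 (2 ^ (i + c + 2)) s

instance (E : Code) (c i j m s : ℕ) : Decidable (tst E c i j m s) := by
  unfold tst; infer_instance

/-- State of the process: current string code and starting stage of its trial. -/
def st (E : Code) (c i : ℕ) : ℕ → ℕ × ℕ
  | 0 => (0, 0)
  | s + 1 => if tst E c i (st E c i s).1 (st E c i s).2 s then ((st E c i s).1 + 1, s + 1)
      else st E c i s

theorem tst_mono {E : Code} {c i j m s t : ℕ} (h : s ≤ t) (H : tst E c i j m s) :
    tst E c i j m t := by
  rcases H with ⟨v, hv, h1⟩ | h1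
  · exact Or.inl ⟨v, by omega, Code.evaln_mono h h1⟩
  · exact Or.inr (Lam_mono h h1)

theorem st_succ_pos {E : Code} {c i s : ℕ} (h : tst E c i (st E c i s).1 (st E c i s).2 s) :
    st E c i (s + 1) = ((st E c i s).1 + 1, s + 1) := by
  rw [st, if_pos h]

theorem st_succ_neg {E : Code} {c i s : ℕ} (h : ¬ tst E c i (st E c i s).1 (st E c i s).2 s) :
    st E c i (s + 1) = st E c i s := by
  rw [st, if_neg h]

theorem st_mono (E : Code) (c i : ℕ) : Monotone fun s => (st E c i s).1 := by
  refine monotone_nat_of_le_succ fun s => ?_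
  by_cases h : tst E c i (st E c i s).1 (st E c i s).2 s
  · simp [st_succ_pos h]
  · simp [st_succ_neg h]

theorem st_eq {E : Code} {c i s t : ℕ} (h : s ≤ t) (h2 : (st E c i t).1 ≤ (st E c i s).1) :
    st E c i t = st E c i s := by
  induction t, h using Nat.le_induction with
  | base => rfl
  | succ t hst ih =>
    by_cases h : tst E c i (st E c i t).1 (st E c i t).2 t
    · rw [st_succ_pos h] at h2
      have : (st E c i s).1 ≤ (st E c i t).1 := st_mono E c i hst
      simp at h2
      omega
    · rw [st_succ_neg h] at h2 ⊢
      exact ih h2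

theorem st_start (E : Code) (c i s : ℕ) :
    (st E c i s).2 ≤ s ∧ st E c i (st E c i s).2 = st E c i s := by
  induction s with
  | zero => exact ⟨le_rfl, rfl⟩
  | succ s ih =>
    by_cases h : tst E c i (st E c i s).1 (st E c i s).2 s
    · have := st_succ_pos h
      refine ⟨by rw [this], ?_⟩
      conv_lhs => rw [this]
    · rw [st_succ_neg h]
      exact ⟨by omega, ih.2⟩

theorem st_succ_of_tst {E : Code} {c i s k : ℕ} (h : tst E c i (st E c i s).1 (st E c i s).2 k) :
    ∃ t, (st E c i s).1 < (st E c i t).1 := by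
  by_contra! hc
  have e : st E c i (max s k) = st E c i s := st_eq (le_max_left _ _) (hc _)
  have h' : tst E c i (st E c i (max s k)).1 (st E c i (max s k)).2 (max s k) := by
    rw [e]; exact tst_mono (le_max_right _ _) h
  have := hc (max s k + 1)
  rw [st_succ_pos h', e] at this
  simp at this

theorem st_reach {E : Code} {c i : ℕ} (hi : ∀ n, ((Denumerable.ofNat Code i).eval n).Dom) (j : ℕ) :
    ∃ s, (st E c i s).1 = j := by
  induction j with
  | zero => exact ⟨0, rfl⟩
  | succ j ih =>
    obtain ⟨s, rfl⟩ := ih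
    have : ∃ t, (st E c i s).1 < (st E c i t).1 := by
      obtain ⟨v, hv⟩ := Part.dom_iff_mem.1 (hi (Nat.pair i (st E c i s).2))
      obtain ⟨k, hk⟩ := Code.evaln_complete.1 hv
      refine st_succ_of_tst (k := max k (v + 1)) (Or.inl ⟨v, ?_, ?_⟩)
      · exact lt_of_lt_of_le (Nat.lt_succ_self v) (le_max_right _ _)
      · exact Code.evaln_mono (le_max_left _ _) hk
    classical
    have hspec := Nat.find_spec this
    have hmin := fun m => Nat.find_min this (m := m)
    generalize Nat.find this = t at hspec hmin
    cases t with
    | zero => simp [st] at hspec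
    | succ t =>
      refine ⟨t + 1, ?_⟩
      have h1 := hmin t (Nat.lt_succ_self t)
      by_cases h : tst E c i (st E c i t).1 (st E c i t).2 t
      · rw [st_succ_pos h] at hspec ⊢
        simp only at hspec ⊢
        omega
      · rw [st_succ_neg h] at hspec
        exact absurd hspec h1

/-- The end of a trial of a string of small measure witnesses an escape. -/
theorem st_escape {E : Code} {C : OracleCode} (hE : Sim E C) {c i s t : ℕ} {g : ℕ → ℕ}
    (hi : (Denumerable.ofNat Code i).eval = natFun g)
    (hs : (st E c i s).2 = s)
    (hsm : ((2 ^ (i + c + 2) : ℕ) : ℝ≥0∞) * stringMeasure (US C (strOf (st E c i s).1)) ≤ 1)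
    (ht : (st E c i s).1 < (st E c i t).1) : g (Nat.pair i s) < t := by
  induction t with
  | zero => simp [st] at ht
  | succ t ih =>
    by_cases hlt : (st E c i s).1 < (st E c i t).1
    · have := ih hlt
      omega
    · have hst : s ≤ t := by
        by_contra! h
        have := st_mono E c i (show t + 1 ≤ s by omega)
        simp only at this
        omega
      have e := st_eq hst (not_lt.1 hlt)
      by_cases h : tst E c i (st E c i t).1 (st E c i t).2 t
      · rw [e, hs] at h
        rcases h with ⟨v, hv, h1⟩ | h1
        · have h2 := Code.evaln_sound h1
          rw [hi] at h2
          have : v = g (Nat.pair i s) := Part.mem_some_iff.1 h2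
          omega
        · have := (exists_Lam hE).1 ⟨_, h1⟩
          rw [Nat.cast_one] at this
          exact absurd this (not_lt.2 hsm)
      · rw [st_succ_neg h] at ht
        exact absurd ht hlt

theorem tst_primrec (E : Code) : PrimrecPred fun p : (ℕ × ℕ) × (ℕ × (ℕ × ℕ)) =>
    tst E p.1.1 p.1.2 p.2.2.1 p.2.2.2 p.2.1 := by
  have hi : Primrec fun p : (ℕ × ℕ) × (ℕ × (ℕ × ℕ)) => p.1.2 := Primrec.snd.comp Primrec.fst
  have hc : Primrec fun p : (ℕ × ℕ) × (ℕ × (ℕ × ℕ)) => p.1.1 := Primrec.fst.comp Primrec.fst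
  have hs : Primrec fun p : (ℕ × ℕ) × (ℕ × (ℕ × ℕ)) => p.2.1 := Primrec.fst.comp Primrec.snd
  have hj : Primrec fun p : (ℕ × ℕ) × (ℕ × (ℕ × ℕ)) => p.2.2.1 :=
    Primrec.fst.comp (Primrec.snd.comp Primrec.snd)
  have hm : Primrec fun p : (ℕ × ℕ) × (ℕ × (ℕ × ℕ)) => p.2.2.2 :=
    Primrec.snd.comp (Primrec.snd.comp Primrec.snd)
  refine PrimrecPred.or ?_ ?_
  · have h : PrimrecRel fun (v : ℕ) (p : (ℕ × ℕ) × (ℕ × (ℕ × ℕ))) =>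
        evaln p.2.1 (Denumerable.ofNat Code p.1.2) (Nat.pair p.1.2 p.2.2.2) = some v := by
      refine Primrec.eq.comp ?_ (Primrec.option_some.comp Primrec.fst)
      exact Code.primrec_evaln.comp (Primrec.pair (Primrec.pair (hs.comp Primrec.snd)
        ((Primrec.ofNat Code).comp (hi.comp Primrec.snd)))
        (Primrec₂.natPair.comp (hi.comp Primrec.snd) (hm.comp Primrec.snd)))
    exact (primrec_exists_lt h).comp hs Primrec.id
  · exact (Lam_primrec E).comp (Primrec.pair (Primrec.pair (strOf_primrec.comp hj)
      (Primrec.pair (Primrec.const 1) (pow_two_primrec.comp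
        (Primrec.nat_add.comp (Primrec.nat_add.comp hi hc) (Primrec.const 2))))) hs)

theorem st_primrec (E : Code) : Primrec fun p : (ℕ × ℕ) × ℕ => st E p.1.1 p.1.2 p.2 := by
  refine (Primrec.nat_rec' (f := fun p : (ℕ × ℕ) × ℕ => p.2) (g := fun _ => (0, 0))
    (h := fun p (q : ℕ × (ℕ × ℕ)) => if tst E p.1.1 p.1.2 q.2.1 q.2.2 q.1 then
      (q.2.1 + 1, q.1 + 1) else q.2) Primrec.snd (Primrec.const _) ?_).of_eq ?_
  · refine Primrec.to₂ (f := fun r : ((ℕ × ℕ) × ℕ) × (ℕ × (ℕ × ℕ)) =>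
      if tst E r.1.1.1 r.1.1.2 r.2.2.1 r.2.2.2 r.2.1 then
      (r.2.2.1 + 1, r.2.1 + 1) else r.2.2) (Primrec.ite ?_ ?_ ?_)
    · exact (tst_primrec E).comp (Primrec.pair (Primrec.fst.comp Primrec.fst) Primrec.snd)
    · exact Primrec.pair (Primrec.succ.comp (Primrec.fst.comp (Primrec.snd.comp Primrec.snd)))
        (Primrec.succ.comp (Primrec.fst.comp Primrec.snd))
    · exact Primrec.snd.comp Primrec.snd
  · rintro ⟨⟨c, i⟩, s⟩
    induction s with
    | zero => rfl
    | succ s ih => simp only at ih; simp only [st, ← ih]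

/-! ### The test -/

/-- Stuck trials of the process with index `i`. -/
def WS (E : Code) (C : OracleCode) (c i : ℕ) : Set (List Bool) :=
  {τ | ∃ s, (∀ t, (st E c i t).1 ≤ (st E c i s).1) ∧ τ ∈ US C (strOf (st E c i s).1)}

theorem WS_measure {E : Code} {C : OracleCode} (hE : Sim E C) (c i : ℕ) :
    stringMeasure (WS E C c i) ≤ (2 : ℝ≥0∞)⁻¹ ^ (i + c + 2) := by
  by_cases h : ∃ s, ∀ t, (st E c i t).1 ≤ (st E c i s).1
  · obtain ⟨s, hs⟩ := h
    have hsub : WS E C c i ⊆ US C (strOf (st E c i s).1) := by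
      rintro τ ⟨s', hs', hτ⟩
      rwa [le_antisymm (hs' s) (hs s')]
    refine (stringMeasure_mono hsub).trans ?_
    have hle : ((2 ^ (i + c + 2) : ℕ) : ℝ≥0∞) * stringMeasure (US C (strOf (st E c i s).1)) ≤ 1 := by
      by_contra! hlt
      rw [← Nat.cast_one, ← exists_Lam hE] at hlt
      obtain ⟨k, hk⟩ := hlt
      obtain ⟨t, ht⟩ := st_succ_of_tst (E := E) (c := c) (i := i) (s := s) (k := k) (Or.inr hk)
      exact absurd (hs t) (not_le.2 ht)
    push_cast at hle
    rw [← ENNReal.inv_pow]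
    rw [mul_comm] at hle
    rwa [← one_div, ENNReal.le_div_iff_mul_le (by simp) (by simp)]
  · have : WS E C c i = ∅ := by
      ext τ
      simp only [Set.mem_empty_iff_false, iff_false]
      rintro ⟨s, hs, _⟩
      exact h ⟨s, hs⟩
    rw [this, stringMeasure_empty]
    exact zero_le

theorem VS_test {E : Code} {C : OracleCode} (hE : Sim E C) :
    MLTest zeroJump fun c => ⋃ i, WS E C c i := by
  refine ⟨?_, fun c => ?_⟩
  · -- uniformly c.e. in the halting problem
    have hpc : Primrec fun y : ℕ => y.unpair.1.unpair.1 :=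
      Primrec.fst.comp (Primrec.unpair.comp (Primrec.fst.comp Primrec.unpair))
    have hpt : Primrec fun y : ℕ => strOf y.unpair.1.unpair.2 :=
      strOf_primrec.comp (Primrec.snd.comp (Primrec.unpair.comp (Primrec.fst.comp Primrec.unpair)))
    have hpi : Primrec fun y : ℕ => y.unpair.2.unpair.1 :=
      Primrec.fst.comp (Primrec.unpair.comp (Primrec.snd.comp Primrec.unpair))
    have hpr : Primrec fun y : ℕ => y.unpair.2.unpair.2.unpair :=
      Primrec.unpair.comp (Primrec.snd.comp (Primrec.unpair.comp (Primrec.snd.comp Primrec.unpair)))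
    have hst : Primrec fun y : ℕ => (st E y.unpair.1.unpair.1 y.unpair.2.unpair.1
        y.unpair.2.unpair.2.unpair.1).1 :=
      Primrec.fst.comp ((st_primrec E).comp (Primrec.pair (Primrec.pair hpc hpi)
        (Primrec.fst.comp hpr)))
    have hD : Primrec fun y : ℕ => decide (Ust E y.unpair.2.unpair.2.unpair.2
        (strOf (st E y.unpair.1.unpair.1 y.unpair.2.unpair.1
          y.unpair.2.unpair.2.unpair.1).1) (strOf y.unpair.1.unpair.2)) :=
      ((Ust_primrec E).comp (Primrec.pair (Primrec.snd.comp hpr)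
        (Primrec.pair (strOf_primrec.comp hst) hpt))).decide
    have hT : Primrec fun p : ℕ × ℕ => decide ((st E p.1.unpair.1.unpair.1 p.1.unpair.2.unpair.1
        p.1.unpair.2.unpair.2.unpair.1).1 < (st E p.1.unpair.1.unpair.1 p.1.unpair.2.unpair.1
        p.2).1) :=
      (Primrec.nat_lt.comp (hst.comp Primrec.fst)
        (Primrec.fst.comp ((st_primrec E).comp (Primrec.pair (Primrec.pair
          (hpc.comp Primrec.fst) (hpi.comp Primrec.fst)) Primrec.snd)))).decide
    have hh := Partrec.nat_iff.1 (Partrec.rfind (hT.to_comp.to₂).partrec₂)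
    obtain ⟨d, hd⟩ := sigma_zeroJump hh hD
    refine ⟨d, fun c σ => ?_⟩
    rw [hd]
    constructor
    · intro h
      obtain ⟨i, s, hs, hτ⟩ := Set.mem_iUnion.1 h
      obtain ⟨k, hk⟩ := (exists_Ust hE).2 hτ
      refine ⟨Nat.pair i (Nat.pair s k), ?_, ?_⟩
      · simpa using hk
      · intro hdom
        obtain ⟨t, ht, _⟩ := Nat.rfind_dom.1 hdom
        simp only [Nat.unpair_pair] at ht
        have ht2 : true = decide ((st E c i s).1 < (st E c i t).1) := Part.mem_some_iff.1 ht
        exact absurd (hs t) (not_le.2 (by simpa using ht2))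
    · rintro ⟨w, hw, hnd⟩
      refine Set.mem_iUnion.2 ⟨w.unpair.1, w.unpair.2.unpair.1, fun t => ?_, ?_⟩
      · by_contra! ht
        apply hnd
        refine Nat.rfind_dom.2 ⟨t, ?_, fun _ => trivial⟩
        simpa using ht
      · refine (exists_Ust hE).1 ⟨w.unpair.2.unpair.2, ?_⟩
        simpa using hw
  · refine lt_of_le_of_lt ((stringMeasure_iUnion_le _).trans
      (ENNReal.tsum_le_tsum fun i => WS_measure hE c i)) ?_
    have : ∀ i : ℕ, (2 : ℝ≥0∞)⁻¹ ^ (i + c + 2) = 2⁻¹ ^ i * 2⁻¹ ^ (c + 2) := by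
      intro i; rw [add_assoc, pow_add]
    simp only [this]
    rw [ENNReal.tsum_mul_right, ENNReal.tsum_geometric, ENNReal.one_sub_inv_two, inv_inv,
      show c + 2 = c + 1 + 1 from rfl, pow_succ, mul_comm, mul_assoc,
      ENNReal.inv_mul_cancel (by simp) (by simp), mul_one]
    rw [pow_succ, ← div_eq_mul_inv]
    exact ENNReal.half_lt_self (by simp) (by simp)

/-! ### The escaping function -/

theorem TotRec.prec {g : ℕ →. ℕ} {f h : ℕ → ℕ} (hf : TotRec g f) (hh : TotRec g h) :
    TotRec g fun x => Nat.rec (motive := fun _ => ℕ) (f x.unpair.1)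
      (fun y IH => h (Nat.pair x.unpair.1 (Nat.pair y IH))) x.unpair.2 := by
  refine (Nat.RecursiveIn.prec hf hh).of_eq fun x => ?_
  change Nat.rec (motive := fun _ => Part ℕ) (natFun f x.unpair.1) (fun y IH => IH.bind fun i =>
      natFun h (Nat.pair x.unpair.1 (Nat.pair y i))) x.unpair.2 =
    Part.some (Nat.rec (motive := fun _ => ℕ) (f x.unpair.1)
      (fun y IH => h (Nat.pair x.unpair.1 (Nat.pair y IH))) x.unpair.2)
  generalize x.unpair.1 = a
  induction x.unpair.2 with
  | zero => rfl
  | succ n ih =>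
    have e : ∀ p : Part ℕ, p = Part.some (Nat.rec (motive := fun _ => ℕ) (f a)
        (fun y IH => h (Nat.pair a (Nat.pair y IH))) n) →
        (p.bind fun i => natFun h (Nat.pair a (Nat.pair n i))) =
        Part.some (h (Nat.pair a (Nat.pair n (Nat.rec (motive := fun _ => ℕ) (f a)
        (fun y IH => h (Nat.pair a (Nat.pair y IH))) n)))) := by
      rintro p rfl
      simp [natFun]
    exact e _ ih

theorem TotRec.find {g : ℕ →. ℕ} {q : ℕ → ℕ} (hq : TotRec g q) {T : ℕ → ℕ → Prop}
    [∀ x, DecidablePred (T x)] (hT : ∀ x w, q (Nat.pair x w) = 0 ↔ T x w)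
    (hex : ∀ x, ∃ w, T x w) : TotRec g fun x => Nat.find (hex x) := by
  refine hq.rfind.of_eq fun x => Part.eq_some_iff.2 ?_
  refine Nat.mem_rfind.2 ⟨?_, fun {m} hm => ?_⟩
  · have := Nat.find_spec (hex x)
    simp [natFun, hT, this]
  · have := Nat.find_min (hex x) hm
    simp [natFun, hT, this]

theorem TotRec.pre (B : ℕ → Bool) : TotRec (TypicalDegree.chi B) fun k =>
    Encodable.encode (pre B k) := by
  have hG : Primrec fun y : ℕ => Encodable.encode (strOf y.unpair.1 ++ [decide (y.unpair.2 = 1)]) :=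
    Primrec.encode.comp (Primrec.list_append.comp
      (strOf_primrec.comp (Primrec.fst.comp Primrec.unpair))
      (Primrec.list_cons.comp (Primrec.eq.comp (Primrec.snd.comp Primrec.unpair)
        (Primrec.const 1)).decide (Primrec.const [])))
  have h2 : Primrec fun y : ℕ => y.unpair.2.unpair.2 :=
    Primrec.snd.comp (Primrec.unpair.comp (Primrec.snd.comp Primrec.unpair))
  have h1 : Primrec fun y : ℕ => y.unpair.2.unpair.1 :=
    Primrec.fst.comp (Primrec.unpair.comp (Primrec.snd.comp Primrec.unpair))
  have hh := (TotRec.of_primrec (g := TypicalDegree.chi B) hG).comp ((TotRec.of_primrec h2).pair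
    ((TotRec.chi B).comp (TotRec.of_primrec h1)))
  have hp := ((TotRec.of_primrec (g := TypicalDegree.chi B)
    (Primrec.const (Encodable.encode ([] : List Bool)))).prec hh).comp
    (TotRec.of_primrec (Primrec₂.natPair.comp (Primrec.const 0) Primrec.id))
  refine Nat.RecursiveIn.of_eq hp fun k => congrArg Part.some ?_
  simp only [Nat.unpair_pair, id]
  induction k with
  | zero => rfl
  | succ k ih =>
    simp only [ih, strOf_encode, pre_succ]
    cases B k <;> simp

set_option maxHeartbeats 1000000 in
theorem escape_function (A B : ℕ → Bool) (hA : TwoRandom A) (hBA : TRed B A)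
    (hB : ¬ ComputableSeq B) : ∃ f : ℕ → ℕ, TotRec (chi B) f ∧
      ∀ g : ℕ → ℕ, ComputableFun g → ∃ n, g n < f n := by
  obtain ⟨C, hC⟩ := hBA
  obtain ⟨E, hE⟩ := exists_sim C
  obtain ⟨c, hc⟩ := hA _ (VS_test hE)
  -- every true trial ends
  have hQ : ∀ x : ℕ, ∃ w, strOf (st E c x.unpair.1 x.unpair.2).1 =
      pre B (strOf (st E c x.unpair.1 x.unpair.2).1).length →
      (st E c x.unpair.1 x.unpair.2).1 < (st E c x.unpair.1 w).1 := by
    intro x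
    generalize x.unpair.1 = i
    generalize x.unpair.2 = s
    by_contra! hx
    have hpre := (hx 0).1
    apply hc
    have hk : ∀ m ≤ (strOf (st E c i s).1).length, ∃ k, ∀ n < m,
        cond (B n) 1 0 ∈ C.eval (strOracle (pre A k)) n := by
      intro m
      induction m with
      | zero => exact fun _ => ⟨0, fun i hi => absurd hi (Nat.not_lt_zero i)⟩
      | succ m ih =>
        intro hm
        obtain ⟨k, hk⟩ := ih (by omega)
        obtain ⟨l, hl⟩ := eval_use A C m (cond (B m) 1 0) (by rw [hC]; exact Part.mem_some _)
        refine ⟨max k l, fun n hn => ?_⟩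
        rcases Nat.lt_succ_iff_lt_or_eq.1 hn with hn | rfl
        · exact eval_mono (strOracle_mono (pre_mono A (le_max_left _ _))) C _ _ (hk n hn)
        · exact eval_mono (strOracle_mono (pre_mono A (le_max_right _ _))) C _ _ hl
    obtain ⟨k, hk⟩ := hk _ le_rfl
    refine ⟨pre A k, Set.mem_iUnion.2 ⟨i, s, fun t => (hx t).2, ?_⟩, ?_⟩
    · intro n b hb
      have hn := (List.getElem?_eq_some_iff.1 hb).1
      rw [hpre, getElem?_pre hn] at hb
      cases hb
      exact hk n hn
    · rw [extendsStr_iff]; simp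
  classical
  refine ⟨fun x => Nat.find (hQ x), ?_, ?_⟩
  · have hx : Primrec fun y : ℕ => y.unpair.1.unpair :=
      Primrec.unpair.comp (Primrec.fst.comp Primrec.unpair)
    have hj : Primrec fun y : ℕ => (st E c y.unpair.1.unpair.1 y.unpair.1.unpair.2).1 :=
      Primrec.fst.comp ((st_primrec E).comp (Primrec.pair
        (Primrec.pair (Primrec.const c) (Primrec.fst.comp hx)) (Primrec.snd.comp hx)))
    have hj' : Primrec fun y : ℕ => (st E c y.unpair.1.unpair.1 y.unpair.2).1 :=
      Primrec.fst.comp ((st_primrec E).comp (Primrec.pair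
        (Primrec.pair (Primrec.const c) (Primrec.fst.comp hx))
        (Primrec.snd.comp Primrec.unpair)))
    have hf1 : Primrec fun z : ℕ => z.unpair.1 := Primrec.fst.comp Primrec.unpair
    have hG : Primrec fun z : ℕ => if
        ((st E c z.unpair.1.unpair.1.unpair.1 z.unpair.1.unpair.1.unpair.2).1 <
          (st E c z.unpair.1.unpair.1.unpair.1 z.unpair.1.unpair.2).1 ∨
        ¬ strOf (st E c z.unpair.1.unpair.1.unpair.1 z.unpair.1.unpair.1.unpair.2).1 =
          strOf z.unpair.2) then 0 else 1 := by
      refine Primrec.ite (PrimrecPred.or ?_ (PrimrecPred.not ?_)) (Primrec.const 0)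
        (Primrec.const 1)
      · exact Primrec.nat_lt.comp (hj.comp hf1) (hj'.comp hf1)
      · exact Primrec.eq.comp (strOf_primrec.comp (hj.comp hf1))
          (strOf_primrec.comp (Primrec.snd.comp Primrec.unpair))
    have h1 := (TotRec.of_primrec (g := chi B) hG).comp ((TotRec.of_primrec Primrec.id).pair
      ((TotRec.pre B).comp (TotRec.of_primrec (Primrec.list_length.comp (strOf_primrec.comp hj)))))
    refine h1.find (fun x w => ?_) hQ
    simp only [Nat.unpair_pair, strOf_encode, id]
    split_ifs with hif
    · exact iff_of_true rfl (imp_iff_not_or.2 (or_comm.1 hif))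
    · exact iff_of_false (by simp) fun hp => hif (or_comm.1 (imp_iff_not_or.1 hp))
  · intro g hg
    obtain ⟨e, he⟩ := Code.exists_code.1 (partrec_of_computableFun hg)
    obtain ⟨i, rfl⟩ : ∃ i, Denumerable.ofNat Code i = e :=
      ⟨Encodable.encode e, Denumerable.ofNat_encode e⟩
    obtain ⟨n, hn⟩ := lam_small hE hB (2 ^ (i + c + 2))
    obtain ⟨s, hs⟩ := st_reach (E := E) (c := c) (i := i) (by intro n; rw [he]; trivial)
      (Encodable.encode (pre B n))
    have hst := (st_start E c i s).2
    generalize hm : (st E c i s).2 = m at hst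
    refine ⟨Nat.pair i m, ?_⟩
    have hspec := Nat.find_spec (hQ (Nat.pair i m))
    change _ < Nat.find (hQ (Nat.pair i m))
    generalize Nat.find (hQ (Nat.pair i m)) = t at hspec ⊢
    simp only [Nat.unpair_pair] at hspec
    refine st_escape hE he (by rw [hst, hm]) ?_ (hspec ?_)
    · rw [hst, hs, strOf_encode]; exact hn
    · rw [hst, hs, strOf_encode, length_pre]

theorem natFun_oracle_mod (f : ℕ → ℕ) : RedIn (natFun fun n => f n % 2) (natFun f) := by
  refine redIn_of_recursiveIn ?_
  have h : TotRec (natFun f) f := Nat.RecursiveIn.oracle _ rfl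
  exact (TotRec.of_primrec (Primrec.nat_mod.comp Primrec.id (Primrec.const 2))).comp h

end

/-- Every non-zero Turing degree that is bounded by a 2-random
Turing degree is hyperimmune: it contains a function `f` not dominated by any
computable function. -/
theorem nonzero_below_twoRandom_hyperimmune (A B : ℕ → Bool)
    (hA : TwoRandom A) (hBA : TRed B A) (hB : ¬ ComputableSeq B) :
    ∃ f : ℕ → ℕ, RedIn (natFun f) (chi B) ∧ RedIn (chi B) (natFun f) ∧
      ∀ g : ℕ → ℕ, ComputableFun g → {n : ℕ | g n < f n}.Infinite := by
  obtain ⟨f, hf, hesc⟩ := escape_function A B hA hBA hB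
  refine ⟨fun n => 2 * f n + cond (B n) 1 0, ?_, ?_, ?_⟩
  · have hG : Primrec fun z : ℕ => 2 * z.unpair.1 + z.unpair.2 :=
      Primrec.nat_add.comp (Primrec.nat_mul.comp (Primrec.const 2)
        (Primrec.fst.comp Primrec.unpair)) (Primrec.snd.comp Primrec.unpair)
    refine redIn_of_recursiveIn (Nat.RecursiveIn.of_eq
      ((TotRec.of_primrec hG).comp (hf.pair (TotRec.chi B))) fun n => ?_)
    simp [natFun]
  · have := natFun_oracle_mod fun n => 2 * f n + cond (B n) 1 0
    convert this using 1
    funext n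
    unfold natFun chi
    cases hBn : B n <;> simp [hBn]
  · intro g hg hfin
    obtain ⟨M, hM⟩ := (hfin.image f).bddAbove
    have hg' : ComputableFun fun n => g n + M := by
      refine redIn_of_partrec (Nat.Partrec.of_eq (Nat.Partrec.comp (Nat.Partrec.of_primrec
        (Primrec.nat_iff.1 (Primrec.nat_add.comp Primrec.id (Primrec.const M))))
        (partrec_of_computableFun hg)) fun n => ?_)
      exact Part.bind_some (g n) _
    obtain ⟨n, hn⟩ := hesc _ hg'
    have h1 : n ∈ {n : ℕ | g n < 2 * f n + cond (B n) 1 0} := by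
      show g n < 2 * f n + _
      omega
    have h2 := hM ⟨n, h1, rfl⟩
    omega

end TypicalDegree
end

section
/- Let Θ be a Turing functional, V a set of finite binary strings, and let F_V be the set of X ∈ 2^ω such that Θ^X is total and does not extend any string in V. Then for almost all X₀ ∈ F_V (all but a set of measure zero), the limit as n → ∞ of μ({X₁ ∈ F_V : Θ^{X₁} ⊇ Θ^{X₀}↾n}) / π(Θ, Θ^{X₀}↾n) equals 1. -/
/-
Common framework: oracle (relative) partial computability via codes,
Turing reducibility, the jump, Cantor-space measure, Martin-Löf randomness
and genericity relative to an oracle, Turing functionals.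
-/

open scoped ENNReal

namespace TypicalDegree

/-- `F_V`: the set of `X` such that `Θ^X` is total and does not extend any
string in `V`. -/
def FVset (Θ : OracleCode) (V : Set (List Bool)) : Set (ℕ → Bool) :=
  {X | (∃ Y : ℕ → Bool, FTotal Θ X Y) ∧ ∀ τ ∈ V, ¬ FExtends Θ X τ}

section Helpers
open MeasureTheory Filter Topology

/-- The fair-coin product measure on Cantor space. -/
noncomputable def coin : Measure (ℕ → Bool) :=
  Measure.infinitePi (fun _ : ℕ => (PMF.uniformOfFintype Bool).toMeasure)

instance : IsProbabilityMeasure coin := by unfold coin; infer_instance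

theorem coin_cyl (n : ℕ) (f : Fin n → Bool) :
    coin {X | (fun i : Fin n => X i.1) = f} = (2 ^ n)⁻¹ := by
  have h : {X : ℕ → Bool | (fun i : Fin n => X i.1) = f} =
      Set.pi (Finset.range n : Set ℕ) (fun i => {b | ∀ h : i < n, b = f ⟨i, h⟩}) := by
    ext X
    simp only [Set.mem_ofPred_eq, funext_iff, Set.mem_pi, Finset.coe_range, Set.mem_Iio]
    exact ⟨fun h i hi _ => h ⟨i, hi⟩, fun h i => h i.1 i.2 i.2⟩
  rw [h, coin, Measure.infinitePi_pi _ (fun i _ => .of_discrete)]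
  rw [Finset.prod_congr rfl (g := fun _ => (2 : ℝ≥0∞)⁻¹)]
  · rw [Finset.prod_const, Finset.card_range, ENNReal.inv_pow]
  · intro i hi
    have hi' : i < n := Finset.mem_range.1 hi
    have : {b | ∀ h : i < n, b = f ⟨i, h⟩} = {f ⟨i, hi'⟩} := by
      ext b; simp [hi']
    rw [this, PMF.toMeasure_apply_singleton _ _ .of_discrete]
    simp

theorem prefix_ofFn_iff (X : ℕ → Bool) (σ : List Bool) (n : ℕ) :
    σ <+: List.ofFn (fun i : Fin n => X i.1) ↔ σ.length ≤ n ∧ extendsStr X σ := by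
  rw [List.prefix_iff_getElem]
  simp only [List.length_ofFn, List.getElem_ofFn, extendsStr, List.get_eq_getElem]
  constructor
  · rintro ⟨h, h'⟩
    exact ⟨h, fun i => (h' i.1 i.2).symm⟩
  · rintro ⟨h, h'⟩
    exact ⟨h, fun i hi => (h' ⟨i, hi⟩).symm⟩

theorem coin_openOf (V : Set (List Bool)) : coin (openOf V) = stringMeasure V := by
  classical
  set D : ℕ → Set (ℕ → Bool) := fun n =>
    {X | ∃ σ ∈ V, σ <+: List.ofFn (fun i : Fin n => X i.1)} with hD
  have h1 : openOf V = ⋃ n, D n := by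
    ext X
    simp only [openOf, hD, Set.mem_iUnion, Set.mem_ofPred_eq, prefix_ofFn_iff]
    constructor
    · rintro ⟨σ, hσ, h⟩; exact ⟨σ.length, σ, hσ, le_rfl, h⟩
    · rintro ⟨n, σ, hσ, _, h⟩; exact ⟨σ, hσ, h⟩
  have hmono : Monotone D := by
    intro a b hab X
    simp only [hD, Set.mem_ofPred_eq, prefix_ofFn_iff]
    rintro ⟨σ, hσ, h, h'⟩
    exact ⟨σ, hσ, h.trans hab, h'⟩
  rw [h1, hmono.measure_iUnion, stringMeasure]
  congr 1; ext n
  set S : Finset (Fin n → Bool) := Finset.univ.filter (fun f => ∃ σ ∈ V, σ <+: List.ofFn f) with hS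
  have h2 : D n = ⋃ f ∈ S, {X : ℕ → Bool | (fun i : Fin n => X i.1) = f} := by
    ext X; simp [hD, hS]
  have hm : ∀ f ∈ S, MeasurableSet {X : ℕ → Bool | (fun i : Fin n => X i.1) = f} := by
    intro f _
    have : Measurable (fun (X : ℕ → Bool) (i : Fin n) => X i.1) := by fun_prop
    exact this (MeasurableSet.singleton f)
  rw [h2, measure_biUnion_finset _ hm]
  · simp only [coin_cyl, Finset.sum_const, nsmul_eq_mul, Nat.card_eq_fintype_card,
      Fintype.card_subtype, ENNReal.div_eq_inv_mul, hS]
    rw [mul_comm]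
  · intro f _ g _ hfg
    refine Set.disjoint_left.2 fun X hf hg => hfg ?_
    exact hf.symm.trans hg

theorem isOpen_eq_openOf {U : Set (ℕ → Bool)} (hU : IsOpen U) : ∃ V, U = openOf V := by
  refine ⟨{σ | ∀ X, extendsStr X σ → X ∈ U}, ?_⟩
  ext X
  constructor
  · intro hX
    obtain ⟨I, u, h1, h2⟩ := isOpen_pi_iff.1 hU X hX
    obtain ⟨n, hn⟩ := I.exists_nat_subset_range
    refine ⟨List.ofFn (fun i : Fin n => X i.1), ?_, ?_⟩
    · intro Y hY
      apply h2
      intro i hi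
      have hin : i < n := Finset.mem_range.1 (hn hi)
      have := hY ⟨i, by simpa using hin⟩
      simp at this
      rw [this]
      exact (h1 i hi).2
    · intro i; simp
  · rintro ⟨σ, hσ, h⟩
    exact hσ X h

theorem cantorMeasure_eq (S : Set (ℕ → Bool)) : cantorMeasure S = coin S := by
  apply le_antisymm
  · rw [S.measure_eq_iInf_isOpen coin]
    refine le_iInf fun U => le_iInf fun hSU => le_iInf fun hU => ?_
    obtain ⟨V, rfl⟩ := isOpen_eq_openOf hU
    rw [coin_openOf]
    exact iInf₂_le V hSU
  · refine le_iInf fun V => le_iInf fun hV => ?_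
    rw [← coin_openOf]
    exact measure_mono hV

theorem measurable_mem_eval (c : OracleCode) :
    ∀ n v : ℕ, MeasurableSet {X : ℕ → Bool | v ∈ c.eval (chi X) n} := by
  induction c with
  | zero => intro n v; simp [OracleCode.eval]
  | succ => intro n v; simp [OracleCode.eval]
  | left => intro n v; simp [OracleCode.eval]
  | right => intro n v; simp [OracleCode.eval]
  | oracle =>
    intro n v
    have : Measurable (fun X : ℕ → Bool => X n) := by fun_prop
    have h := this (MeasurableSet.of_discrete (s := {b : Bool | v = cond b 1 0}))
    simpa [OracleCode.eval, chi] using h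
  | pair cf cg hf hg =>
    intro n v
    have : {X : ℕ → Bool | v ∈ (OracleCode.pair cf cg).eval (chi X) n} =
        {X | v.unpair.1 ∈ cf.eval (chi X) n} ∩ {X | v.unpair.2 ∈ cg.eval (chi X) n} := by
      ext X
      simp only [OracleCode.eval, Seq.seq, Part.map_eq_map, Part.mem_bind_iff, Part.mem_map_iff,
        Set.mem_ofPred_eq, Set.mem_inter_iff]
      constructor
      · rintro ⟨_, ⟨a, ha, rfl⟩, b, hb, rfl⟩
        simpa using ⟨ha, hb⟩
      · rintro ⟨ha, hb⟩
        exact ⟨_, ⟨_, ha, rfl⟩, _, hb, by simp⟩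
    rw [this]
    exact (hf _ _).inter (hg _ _)
  | comp cf cg hf hg =>
    intro n v
    have : {X : ℕ → Bool | v ∈ (OracleCode.comp cf cg).eval (chi X) n} =
        ⋃ a : ℕ, {X | a ∈ cg.eval (chi X) n} ∩ {X | v ∈ cf.eval (chi X) a} := by
      ext X
      simp only [OracleCode.eval, Set.mem_iUnion]
      exact Part.mem_bind_iff
    rw [this]
    exact .iUnion fun a => (hg _ _).inter (hf _ _)
  | prec cf cg hf hg =>
    intro n v
    simp only [OracleCode.eval, Nat.unpaired]
    generalize n.unpair.1 = a
    generalize n.unpair.2 = k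
    induction k generalizing v with
    | zero => exact hf a v
    | succ k ih =>
      have : ∀ X : ℕ → Bool, (v ∈ (Nat.rec (OracleCode.eval (chi X) cf a) (fun y IH => do
            let i ← IH
            OracleCode.eval (chi X) cg (Nat.pair a (Nat.pair y i))) (k + 1) : Part ℕ)) ↔
          ∃ i, i ∈ (Nat.rec (OracleCode.eval (chi X) cf a) (fun y IH => do
            let i ← IH
            OracleCode.eval (chi X) cg (Nat.pair a (Nat.pair y i))) k : Part ℕ) ∧
            v ∈ OracleCode.eval (chi X) cg (Nat.pair a (Nat.pair k i)) := by
        intro X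
        simp
      simp only [this]
      rw [Set.ofPred_exists]
      exact .iUnion fun i => (ih i).inter (hg _ _)
  | rfind' cf hf =>
    intro n v
    simp only [OracleCode.eval, Nat.unpaired]
    generalize n.unpair.1 = a
    generalize n.unpair.2 = m
    have : {X : ℕ → Bool | v ∈ (Nat.rfind fun n => (fun m => decide (m = 0)) <$>
          OracleCode.eval (chi X) cf (Nat.pair a (n + m))).map (· + m)} =
        ⋃ k : ℕ, {X : ℕ → Bool | k + m = v} ∩ ({X | 0 ∈ cf.eval (chi X) (Nat.pair a (k + m))} ∩
          ⋂ j : ℕ, ⋂ _ : j < k, ⋃ w : ℕ, {X | w ∈ cf.eval (chi X) (Nat.pair a (j + m))} ∩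
            {_X : ℕ → Bool | w ≠ 0}) := by
      ext X
      simp only [Part.map_eq_map, Part.mem_map_iff, Set.mem_ofPred_eq,
        Set.mem_iUnion, Set.mem_inter_iff, Set.mem_iInter]
      refine exists_congr fun k => ?_
      rw [and_comm]
      refine and_congr Iff.rfl (Nat.mem_rfind.trans ?_)
      simp
    rw [this]
    refine .iUnion fun k => (MeasurableSet.const _).inter ((hf _ _).inter ?_)
    exact .iInter fun j => .iInter fun _ => .iUnion fun w => (hf _ _).inter (MeasurableSet.const _)


open Classical in
/-- The bit output by `c` at place `n`, if there is one. -/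
noncomputable def outBit (c : OracleCode) (n : ℕ) (X : ℕ → Bool) : Option Bool :=
  if 1 ∈ c.eval (chi X) n then some true
  else if 0 ∈ c.eval (chi X) n then some false else none

instance : MeasurableSpace (Option Bool) := ⊤

instance : DiscreteMeasurableSpace (Option Bool) := ⟨fun _ => trivial⟩

theorem measurable_outBit (c : OracleCode) (n : ℕ) : Measurable (outBit c n) := by
  classical
  exact Measurable.ite (measurable_mem_eval c n 1) measurable_const
    (Measurable.ite (measurable_mem_eval c n 0) measurable_const measurable_const)

theorem outBit_eq_some (c : OracleCode) (n : ℕ) (X : ℕ → Bool) (b : Bool) :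
    outBit c n X = some b ↔ c.eval (chi X) n = Part.some (cond b 1 0) := by
  rw [Part.eq_some_iff, outBit]
  by_cases h1 : 1 ∈ c.eval (chi X) n
  · have h0 : 0 ∉ c.eval (chi X) n := fun h0 => by
      have := Part.mem_unique h1 h0; omega
    cases b <;> simp [h1, h0]
  · by_cases h0 : 0 ∈ c.eval (chi X) n <;> cases b <;> simp [h1, h0]

/-- The first `n` outputs of `c`. -/
noncomputable def outBits (c : OracleCode) (n : ℕ) (X : ℕ → Bool) : Fin n → Option Bool :=
  fun i => outBit c i.1 X

theorem measurable_outBits (c : OracleCode) (n : ℕ) : Measurable (outBits c n) :=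
  measurable_pi_lambda _ fun i => measurable_outBit c i.1

/-- The filtration generated by the outputs of `c`. -/
noncomputable def outFil (c : OracleCode) :
    Filtration ℕ (inferInstance : MeasurableSpace (ℕ → Bool)) where
  seq n := MeasurableSpace.comap (outBits c n) inferInstance
  mono' := by
    intro a b hab
    have : outBits c a = (fun (g : Fin b → Option Bool) (i : Fin a) => g (Fin.castLE hab i)) ∘
        outBits c b := rfl
    dsimp only
    rw [this, ← MeasurableSpace.comap_comp]
    apply MeasurableSpace.comap_mono
    apply Measurable.comap_le
    fun_prop
  le' n := (measurable_outBits c n).comap_le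

theorem fExtends_iff (c : OracleCode) (X : ℕ → Bool) (σ : List Bool) :
    FExtends c X σ ↔ outBits c σ.length X = fun i => some (σ.get i) := by
  simp only [FExtends, funext_iff, outBits, outBit_eq_some]

theorem fExtends_outFil (c : OracleCode) (σ : List Bool) :
    MeasurableSet[outFil c σ.length] {X | FExtends c X σ} := by
  simp only [fExtends_iff]
  exact ⟨{fun i => some (σ.get i)}, .of_discrete, rfl⟩

theorem total_iff (c : OracleCode) (X : ℕ → Bool) :
    (∃ Y, FTotal c X Y) ↔ ∀ n, ∃ σ : List Bool, σ.length = n ∧ FExtends c X σ := by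
  constructor
  · rintro ⟨Y, hY⟩ n
    refine ⟨List.ofFn (fun i : Fin n => Y i.1), by simp, fun i => ?_⟩
    rw [hY]; simp [chi]
  · intro h
    choose σ hσ h using h
    refine ⟨fun n => (σ (n + 1)).get ⟨n, by rw [hσ]; omega⟩, ?_⟩
    funext n
    exact h (n + 1) ⟨n, by rw [hσ]; omega⟩

theorem measurable_FVset (c : OracleCode) (V : Set (List Bool)) :
    MeasurableSet[⨆ n, outFil c n] (FVset c V) := by
  have hm : ∀ σ, MeasurableSet[⨆ n, outFil c n] {X | FExtends c X σ} := fun σ =>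
    le_iSup (fun n => outFil c n) σ.length _ (fExtends_outFil c σ)
  have : FVset c V = (⋂ n : ℕ, ⋃ σ : List Bool, ⋃ _ : σ.length = n, {X | FExtends c X σ}) ∩
      ⋂ τ : List Bool, ⋂ _ : τ ∈ V, {X | FExtends c X τ}ᶜ := by
    ext X
    simp [FVset, total_iff]
  rw [this]
  refine MeasurableSet.inter ?_ ?_
  · exact .iInter fun n => .iUnion fun σ => .iUnion fun _ => hm σ
  · exact .iInter fun τ => .iInter fun _ => (hm τ).compl

theorem outStr_spec (c : OracleCode) (X : ℕ → Bool) (h : ∃ Y, FTotal c X Y) (n : ℕ) :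
    FExtends c X (outStr c X n) := by
  have h' : FTotal c X (outSeq c X) := by
    have : outSeq c X = h.choose := by
      funext n; simp only [outSeq]; rw [dif_pos h]
    rw [this]; exact h.choose_spec
  intro i
  have hi : (outStr c X n).get i = outSeq c X i.1 := by
    rw [List.get_eq_getElem]
    unfold outStr
    rw [List.getElem_ofFn]
  rw [h', hi]
  rfl

/-- On an atom of positive measure the conditional expectation is the conditional probability. -/
theorem condExp_atom (c : OracleCode) (F : Set (ℕ → Bool)) (hF : MeasurableSet F)
    (σ : List Bool) (X₀ : ℕ → Bool) (h₀ : FExtends c X₀ σ)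
    (hpos : coin {X | FExtends c X σ} ≠ 0) :
    ENNReal.ofReal ((coin[F.indicator (fun _ => (1 : ℝ)) | outFil c σ.length]) X₀) =
      coin (F ∩ {X | FExtends c X σ}) / coin {X | FExtends c X σ} := by
  set S := {X | FExtends c X σ} with hS
  have hSm' := fExtends_outFil c σ
  have hSm : MeasurableSet S := (outFil c).le _ _ hSm'
  set g := coin[F.indicator (fun _ => (1 : ℝ)) | outFil c σ.length] with hg
  have hgm : StronglyMeasurable[outFil c σ.length] g := stronglyMeasurable_condExp
  have hconst : ∀ X ∈ S, g X = g X₀ := by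
    intro X hX
    have hft : Function.FactorsThrough g (outBits c σ.length) := hgm.factorsThrough
    exact hft (((fExtends_iff c X σ).1 hX).trans ((fExtends_iff c X₀ σ).1 h₀).symm)
  have hint : Integrable (F.indicator (fun _ => (1 : ℝ))) coin :=
    (integrable_const _).indicator hF
  have h1 : ∫ X in S, g X ∂coin = ∫ X in S, F.indicator (fun _ => (1 : ℝ)) X ∂coin :=
    setIntegral_condExp ((outFil c).le _) hint hSm'
  rw [setIntegral_congr_fun hSm hconst, setIntegral_const, integral_indicator_const _ hF,
    smul_eq_mul, smul_eq_mul, mul_one, measureReal_restrict_apply hF] at h1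
  have hSr : 0 < coin.real S := by
    rw [measureReal_def]; exact ENNReal.toReal_pos hpos (measure_ne_top _ _)
  have h2 : g X₀ = coin.real (F ∩ S) / coin.real S := by
    rw [← h1]; field_simp
  rw [h2, ENNReal.ofReal_div_of_pos hSr, ofReal_measureReal, ofReal_measureReal]

theorem theta_density_aux (Θ : OracleCode) (V : Set (List Bool)) :
    cantorMeasure {X₀ | X₀ ∈ FVset Θ V ∧
      ¬ Filter.Tendsto
          (fun n : ℕ =>
            cantorMeasure {X₁ | X₁ ∈ FVset Θ V ∧ FExtends Θ X₁ (outStr Θ X₀ n)} /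
              piMeasure Θ (outStr Θ X₀ n))
          Filter.atTop (nhds (1 : ℝ≥0∞))} = 0 := by
  rw [cantorMeasure_eq]
  simp only [piMeasure, cantorMeasure_eq]
  have hFm' := measurable_FVset Θ V
  have hle : (⨆ n, outFil Θ n) ≤ (inferInstance : MeasurableSpace (ℕ → Bool)) :=
    iSup_le fun n => (outFil Θ).le n
  have hFm : MeasurableSet (FVset Θ V) := hle _ hFm'
  set F := FVset Θ V with hF
  have hlev := MeasureTheory.tendsto_ae_condExp (μ := coin) (ℱ := outFil Θ)
    (F.indicator (fun _ => (1 : ℝ)))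
  have hlim : coin[F.indicator (fun _ => (1 : ℝ)) | ⨆ n, outFil Θ n] =
      F.indicator (fun _ => (1 : ℝ)) :=
    condExp_of_stronglyMeasurable hle
      (stronglyMeasurable_const.indicator hFm')
      ((integrable_const _).indicator hFm)
  rw [hlim] at hlev
  have hnull : ∀ᵐ X ∂coin, ∀ σ : List Bool, FExtends Θ X σ → coin {X | FExtends Θ X σ} ≠ 0 := by
    rw [ae_all_iff]
    intro σ
    by_cases h : coin {X | FExtends Θ X σ} = 0
    · have : ∀ᵐ X ∂coin, ¬ FExtends Θ X σ := by
        rw [ae_iff]; simpa using h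
      filter_upwards [this] with X hX hX'
      exact absurd hX' hX
    · exact Filter.Eventually.of_forall fun _ _ => h
  have hae : ∀ᵐ X₀ ∂coin, ¬ (X₀ ∈ F ∧ ¬ Filter.Tendsto
          (fun n : ℕ => coin {X₁ | X₁ ∈ F ∧ FExtends Θ X₁ (outStr Θ X₀ n)} /
              coin {X | FExtends Θ X (outStr Θ X₀ n)})
          Filter.atTop (nhds (1 : ℝ≥0∞))) := by
    filter_upwards [hlev, hnull] with X₀ h1 h2
    rintro ⟨hX, hnot⟩
    apply hnot
    rw [Set.indicator_of_mem hX] at h1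
    have h3 := ENNReal.tendsto_ofReal h1
    rw [ENNReal.ofReal_one] at h3
    refine h3.congr fun n => ?_
    have hs := outStr_spec Θ X₀ hX.1 n
    have hlen : (outStr Θ X₀ n).length = n := by simp [outStr]
    have := condExp_atom Θ F hFm _ X₀ hs (h2 _ hs)
    rw [hlen] at this
    exact this
  rw [ae_iff] at hae
  simpa only [not_not] using hae

end Helpers

/-- `Θ`-density: for almost all `X₀ ∈ F_V`, the proportion of the
reals that `Θ`-map to `Θ^{X₀} ↾ n` which lie in `F_V` tends to `1` as `n → ∞`. -/
theorem theta_density (Θ : OracleCode) (V : Set (List Bool)) :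
    cantorMeasure {X₀ | X₀ ∈ FVset Θ V ∧
      ¬ Filter.Tendsto
          (fun n : ℕ =>
            cantorMeasure {X₁ | X₁ ∈ FVset Θ V ∧ FExtends Θ X₁ (outStr Θ X₀ n)} /
              piMeasure Θ (outStr Θ X₀ n))
          Filter.atTop (nhds (1 : ℝ≥0∞))} = 0 := by
  exact theta_density_aux Θ V

end TypicalDegree
end
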